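/- arXiv:1709.00705 — 4 statements merged into one kernel-verified Lean document; each statement's English description precedes it below -/
import Mathlib

section
/- For every r∈ℕ₀, every α,β∈ℝ and every 0<p<1, the inclusion B_p^{r+1}(w_{α,β}) ⊆ B_p^r(w_{α,β}) fails: there exists a function f∈B_p^{r+1}(w_{α,β}) such that ‖w_{α,β}φ^r f^{(r)}‖_p = ∞, so that f∉B_p^r(w_{α,β}). -/
open MeasureTheory Set Filter Topology
open scoped ENNReal NNReal

noncomputable section

/-- `phi x = √(1 - x²)`. -/
def phi (x : ℝ) : ℝ := Real.sqrt (1 - x ^ 2)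

/-- Jacobi weight `w_{α,β}(x) = (1-x)^α (1+x)^β`. -/
def jw (a b x : ℝ) : ℝ := (1 - x) ^ a * (1 + x) ^ b

/-- Shifted weight `w̃_δ^{ξ,ζ}(x) = (1-x-δφ(x)/2)^ξ (1+x-δφ(x)/2)^ζ`. -/
def jwt (d xi ze x : ℝ) : ℝ :=
  (1 - x - d * phi x / 2) ^ xi * (1 + x - d * phi x / 2) ^ ze

/-- `Dom_δ = [-1 + 2δ²/(4+δ²), 1 - 2δ²/(4+δ²)]`. -/
def Dom (d : ℝ) : Set ℝ :=
  Icc (-1 + 2 * d ^ 2 / (4 + d ^ 2)) (1 - 2 * d ^ 2 / (4 + d ^ 2))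

open Classical in
/-- `k`-th symmetric difference with step `h`, relative to a set `J`. -/
def sdiffOn (k : ℕ) (h : ℝ) (f : ℝ → ℝ) (J : Set ℝ) (x : ℝ) : ℝ :=
  if Icc (x - k * h / 2) (x + k * h / 2) ⊆ J then
    ∑ i ∈ Finset.range (k + 1),
      (k.choose i : ℝ) * (-1 : ℝ) ^ (k - i) * f (x - k * h / 2 + i * h)
  else 0

/-- `k`-th symmetric difference relative to `[-1,1]`. -/
def sdiff (k : ℕ) (h : ℝ) (f : ℝ → ℝ) (x : ℝ) : ℝ := sdiffOn k h f (Icc (-1) 1) x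

/-- `L_p(J)`-"norm" (extended-real valued; `essSup` when `p = ∞`). -/
def Jnorm (p : ℝ≥0∞) (f : ℝ → ℝ) (J : Set ℝ) : ℝ≥0∞ :=
  eLpNorm f p (volume.restrict J)

/-- The weighted modulus of smoothness `ω_{k,r}^φ(g, t)_{α,β,p}` (here `g` plays the
role of `f^{(r)}`). -/
def wmod (k r : ℕ) (a b : ℝ) (p : ℝ≥0∞) (g : ℝ → ℝ) (t : ℝ) : ℝ≥0∞ :=
  ⨆ h ∈ Ioc (0 : ℝ) t,
    Jnorm p
      (fun x => jwt (k * h) ((r : ℝ) / 2 + a) ((r : ℝ) / 2 + b) x * sdiff k (h * phi x) g x)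
      (Icc (-1) 1)

/-- The averaged weighted modulus `ω_{k,r}^{*φ}(g, t)_{α,β,p}`. -/
def wmodAvg (k r : ℕ) (a b : ℝ) (p : ℝ≥0∞) (g : ℝ → ℝ) (t : ℝ) : ℝ≥0∞ :=
  if p = ∞ then wmod k r a b p g t
  else
    (ENNReal.ofReal (1 / t) *
        ∫⁻ τ in Ioc (0 : ℝ) t, ∫⁻ x in Dom (k * τ),
          (ENNReal.ofReal
              |jwt (k * τ) ((r : ℝ) / 2 + a) ((r : ℝ) / 2 + b) x *
                sdiff k (τ * phi x) g x|) ^ p.toReal) ^ (1 / p.toReal)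

/-- Local absolute continuity on `(-1,1)`: on each compact subinterval, `g` is an
indefinite integral of its (a.e.) derivative. -/
def ACloc (g : ℝ → ℝ) : Prop :=
  ∀ a b : ℝ, -1 < a → a ≤ b → b < 1 →
    IntegrableOn (deriv g) (Icc a b) ∧
      ∀ x ∈ Icc a b, g x = g a + ∫ u in a..x, deriv g u

/-- Membership in `B_p^r(w_{α,β})`. -/
def MemB (p : ℝ≥0∞) (r : ℕ) (a b : ℝ) (f : ℝ → ℝ) : Prop :=
  (1 ≤ r → ACloc (iteratedDeriv (r - 1) f)) ∧
    Jnorm p (fun x => jw a b x * phi x ^ r * iteratedDeriv r f x) (Icc (-1) 1) < ⊤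

/-- The weighted `K`-functional `K_{k,r}^φ(f^{(r)}, tk)_{α,β,p}` (here `tk = t^k`). -/
def Kfun (k r : ℕ) (a b : ℝ) (p : ℝ≥0∞) (f : ℝ → ℝ) (tk : ℝ) : ℝ≥0∞ :=
  ⨅ g ∈ {g : ℝ → ℝ | MemB p (k + r) a b g},
    Jnorm p
        (fun x => jw a b x * phi x ^ r * (iteratedDeriv r f x - iteratedDeriv r g x))
        (Icc (-1) 1) +
      ENNReal.ofReal tk *
        Jnorm p (fun x => jw a b x * phi x ^ (k + r) * iteratedDeriv (k + r) g x)
          (Icc (-1) 1)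

/-- `P` is (the evaluation of) an algebraic polynomial of degree strictly less than `n`. -/
def IsPolyLt (n : ℕ) (P : ℝ → ℝ) : Prop :=
  ∃ q : Polynomial ℝ, q.degree < (n : WithBot ℕ) ∧ ∀ x, P x = q.eval x

/-- The realization functional `R_{k,r}^φ(f^{(r)}, n^{-k})_{α,β,p}`. -/
def Rfun (k r : ℕ) (a b : ℝ) (p : ℝ≥0∞) (f : ℝ → ℝ) (n : ℕ) : ℝ≥0∞ :=
  ⨅ P ∈ {P : ℝ → ℝ | IsPolyLt n P},
    Jnorm p
        (fun x => jw a b x * phi x ^ r * (iteratedDeriv r f x - iteratedDeriv r P x))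
        (Icc (-1) 1) +
      ENNReal.ofReal (1 / (n : ℝ) ^ k) *
        Jnorm p (fun x => jw a b x * phi x ^ (k + r) * iteratedDeriv (k + r) P x)
          (Icc (-1) 1)

/-- The error of best weighted polynomial approximation `E_k(f, J)_{w,p}`. -/
def Eerr (k : ℕ) (w : ℝ → ℝ) (p : ℝ≥0∞) (f : ℝ → ℝ) (J : Set ℝ) : ℝ≥0∞ :=
  ⨅ q ∈ {P : ℝ → ℝ | IsPolyLt k P}, Jnorm p (fun x => w x * (f x - q x)) J

/-- The weighted Ditzian–Totik modulus `ω_φ^k(f,t)_{w,p}`. -/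
def dtMod (k : ℕ) (w : ℝ → ℝ) (p : ℝ≥0∞) (f : ℝ → ℝ) (t : ℝ) : ℝ≥0∞ :=
  (⨆ h ∈ Ioc (0 : ℝ) t,
      Jnorm p (fun x => w x * sdiff k (h * phi x) f x)
        (Icc (-1 + 2 * (k : ℝ) ^ 2 * t ^ 2) (1 - 2 * (k : ℝ) ^ 2 * t ^ 2))) +
    (⨆ h ∈ Ioc (0 : ℝ) (2 * (k : ℝ) ^ 2 * t ^ 2),
      Jnorm p (fun x => w x * sdiff k h f (x + k * h / 2))
        (Icc (-1) (-1 + 12 * (2 * (k : ℝ) ^ 2 * t ^ 2)))) +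
    (⨆ h ∈ Ioc (0 : ℝ) (2 * (k : ℝ) ^ 2 * t ^ 2),
      Jnorm p (fun x => w x * sdiff k h f (x - k * h / 2))
        (Icc (1 - 12 * (2 * (k : ℝ) ^ 2 * t ^ 2)) 1))

/-- The main part weighted modulus `Ω_φ^k(f, A, t)_{p,w}`. -/
def mainMod (k : ℕ) (A : ℝ) (p : ℝ≥0∞) (w : ℝ → ℝ) (f : ℝ → ℝ) (t : ℝ) : ℝ≥0∞ :=
  ⨆ h ∈ Ioc (0 : ℝ) t,
    Jnorm p
      (fun x => w x * sdiffOn k (h * phi x) f (Icc (-1 + A * h ^ 2) (1 - A * h ^ 2)) x)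
      (Icc (-1 + A * h ^ 2) (1 - A * h ^ 2))

/-- The averaged main part weighted modulus `Ω̃_φ^k(f, A, t)_{p,w}`. -/
def mainModAvg (k : ℕ) (A : ℝ) (p : ℝ≥0∞) (w : ℝ → ℝ) (f : ℝ → ℝ) (t : ℝ) : ℝ≥0∞ :=
  if p = ∞ then mainMod k A p w f t
  else
    (ENNReal.ofReal (1 / t) *
        ∫⁻ h in Ioc (0 : ℝ) t,
          (Jnorm p
              (fun x =>
                w x * sdiffOn k (h * phi x) f (Icc (-1 + A * h ^ 2) (1 - A * h ^ 2)) x)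
              (Icc (-1 + A * h ^ 2) (1 - A * h ^ 2))) ^ p.toReal) ^ (1 / p.toReal)

/-- The complete weighted modulus `ω_φ^k(f, A, t)_{p,w}`. -/
def fullMod (k : ℕ) (A : ℝ) (p : ℝ≥0∞) (w : ℝ → ℝ) (f : ℝ → ℝ) (t : ℝ) : ℝ≥0∞ :=
  mainMod k A p w f t + Eerr k w p f (Icc (-1) (-1 + 2 * A * t ^ 2)) +
    Eerr k w p f (Icc (1 - 2 * A * t ^ 2) 1)

/-- The complete averaged weighted modulus `ω̃_φ^k(f, A, t)_{p,w}`. -/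
def fullModAvg (k : ℕ) (A : ℝ) (p : ℝ≥0∞) (w : ℝ → ℝ) (f : ℝ → ℝ) (t : ℝ) : ℝ≥0∞ :=
  mainModAvg k A p w f t + Eerr k w p f (Icc (-1) (-1 + 2 * A * t ^ 2)) +
    Eerr k w p f (Icc (1 - 2 * A * t ^ 2) 1)


/-- A continuous function on `(-1,1)` concentrated on thin peaks around the points `1 - 1/n`. -/
def peaks (k m : ℕ) (x : ℝ) : ℝ :=
  (1 - x)⁻¹ ^ k * max 0 (x - (1 - x)⁻¹ ^ m * |Real.sin (Real.pi * (1 - x)⁻¹)|)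

lemma continuousOn_peaks (k m : ℕ) : ContinuousOn (peaks k m) (Ioo (-1) 1) := by
  have h : ContinuousOn (fun x : ℝ => (1 - x)⁻¹) (Ioo (-1) 1) :=
    ContinuousOn.inv₀ (by fun_prop) fun x hx => by linarith [hx.2]
  unfold peaks
  refine (h.pow k).mul (continuousOn_const.sup (continuousOn_id.sub ((h.pow m).mul ?_)))
  exact (Real.continuous_sin.comp_continuousOn (continuousOn_const.mul h)).abs

lemma peaks_nonneg (k m : ℕ) {x : ℝ} (hx : x < 1) : 0 ≤ peaks k m x :=
  mul_nonneg (pow_nonneg (inv_nonneg.2 (by linarith)) _) (le_max_left _ _)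

lemma hasDerivAt_integral_of_continuousOn_Ioo {F : ℝ → ℝ} (hF : ContinuousOn F (Ioo (-1) 1))
    {x : ℝ} (hx : x ∈ Ioo (-1 : ℝ) 1) : HasDerivAt (fun y => ∫ u in (0 : ℝ)..y, F u) (F x) x := by
  have h0 : (0 : ℝ) ∈ Ioo (-1 : ℝ) 1 := by constructor <;> norm_num
  have hsub : uIcc 0 x ⊆ Ioo (-1 : ℝ) 1 := ordConnected_Ioo.uIcc_subset h0 hx
  refine intervalIntegral.integral_hasDerivAt_right (hF.mono hsub).intervalIntegrable ?_
    (hF.continuousAt (isOpen_Ioo.mem_nhds hx))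
  exact hF.stronglyMeasurableAtFilter isOpen_Ioo x hx

lemma exists_iteratedDeriv_eq_on_Ioo (r : ℕ) {g : ℝ → ℝ} (hg : ContinuousOn g (Ioo (-1) 1)) :
    ∃ f : ℝ → ℝ, ∀ x ∈ Ioo (-1 : ℝ) 1, iteratedDeriv r f x = g x := by
  induction r generalizing g with
  | zero => exact ⟨g, fun x _ => by simp⟩
  | succ n ih =>
    have hd := fun x hx => hasDerivAt_integral_of_continuousOn_Ioo hg (x := x) hx
    obtain ⟨f, hf⟩ := ih fun x hx => (hd x hx).continuousAt.continuousWithinAt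
    refine ⟨f, fun x hx => ?_⟩
    rw [iteratedDeriv_succ]
    refine ((hd x hx).congr_of_eventuallyEq ?_).deriv
    filter_upwards [isOpen_Ioo.mem_nhds hx] with y hy using hf y hy

/-- Some positive integer comparable to `s ≥ 1` is within `|sin (π s)|` of `s`. -/
lemma exists_nat_abs_sub_le_sin {s : ℝ} (hs : 1 ≤ s) :
    ∃ n : ℕ, 1 ≤ n ∧ (n : ℝ) ≤ 2 * s ∧ s ≤ 2 * n ∧ |s - n| ≤ |Real.sin (Real.pi * s)| := by
  have hr := abs_sub_round s
  have hr' := abs_le.1 hr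
  have h1 : (0 : ℤ) < round s := by
    have : (0 : ℝ) < round s := by linarith
    exact_mod_cast this
  obtain ⟨n, hn⟩ := Int.eq_ofNat_of_zero_le h1.le
  have hn1 : 1 ≤ n := by omega
  have hc : ((round s : ℤ) : ℝ) = n := by rw [hn]; simp
  rw [hc] at hr hr'
  have hn1' : (1 : ℝ) ≤ n := by exact_mod_cast hn1
  refine ⟨n, hn1, by linarith, by linarith, ?_⟩
  have hsin : |Real.sin (Real.pi * s)| = |Real.sin (Real.pi * (s - n))| := by
    have : Real.pi * (s - n) = Real.pi * s - n * Real.pi := by ring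
    rw [this, Real.sin_sub_nat_mul_pi, abs_mul]
    simp
  rw [hsin]
  have h2 := Real.mul_abs_le_abs_sin (x := Real.pi * (s - n)) (by
    rw [abs_mul, abs_of_pos Real.pi_pos]
    nlinarith [Real.pi_pos])
  rw [abs_mul, abs_of_pos Real.pi_pos] at h2
  have h3 : 2 / Real.pi * (Real.pi * |s - n|) = 2 * |s - n| := by
    field_simp
  rw [h3] at h2
  linarith [abs_nonneg (s - n)]

lemma le_integral_peaks (k m : ℕ) {x : ℝ} (hx : x ∈ Ioo (2 / 3 : ℝ) 1) :
    (1 - x)⁻¹ ^ k / (3 ^ k * 64 * (1 - x)⁻¹ ^ (m + 2)) ≤ ∫ u in (0 : ℝ)..x, peaks k m u := by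
  obtain ⟨hx1, hx2⟩ := hx
  set s := (1 - x)⁻¹ with hs
  have hs3 : 3 < s := by
    rw [hs, lt_inv_comm₀ (by norm_num) (by linarith)]; linarith
  obtain ⟨n, hn, hn'⟩ : ∃ n : ℕ, (n + 1 : ℝ) ≤ s ∧ s < n + 2 := by
    have h1 := Nat.floor_le (show 0 ≤ s by linarith)
    have h2 := Nat.lt_floor_add_one s
    have h3 : 1 ≤ ⌊s⌋₊ := Nat.le_floor (by push_cast; linarith)
    refine ⟨⌊s⌋₊ - 1, ?_, ?_⟩ <;> push_cast [Nat.cast_sub h3] <;> linarith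
  have hn2 : (2 : ℝ) ≤ n := by
    have : 1 < n := by
      have : (1 : ℝ) < n := by linarith
      exact_mod_cast this
    exact_mod_cast this
  set δ : ℝ := 1 / (16 * s ^ m) with hδ
  have hsm : 1 ≤ s ^ m := one_le_pow₀ (by linarith)
  have hδ0 : 0 < δ := by positivity
  have hδ1 : δ ≤ 1 := by
    rw [hδ, div_le_one (by positivity)]; linarith
  set c : ℝ := 1 - (n : ℝ)⁻¹ with hc
  set d : ℝ := 1 - (n + δ)⁻¹ with hd
  have hcd : c ≤ d := by
    have : ((n : ℝ) + δ)⁻¹ ≤ (n : ℝ)⁻¹ := inv_anti₀ (by linarith) (by linarith)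
    linarith
  have hc2 : 1 / 2 ≤ c := by
    have : (n : ℝ)⁻¹ ≤ 2⁻¹ := inv_anti₀ (by norm_num) hn2
    norm_num at this ⊢; linarith
  have hdx : d ≤ x := by
    have : s⁻¹ ≤ ((n : ℝ) + δ)⁻¹ := inv_anti₀ (by linarith) (by linarith)
    rw [hs, inv_inv] at this
    linarith
  have hlen : δ / s ^ 2 ≤ d - c := by
    have : d - c = δ / (n * (n + δ)) := by
      rw [hd, hc]; field_simp; ring
    rw [this]
    gcongr
    nlinarith
  have hlow : ∀ y ∈ Icc c d, (s / 3) ^ k * (1 / 4) ≤ peaks k m y := by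
    intro y hy
    have hy1 : y < 1 := by linarith [hy.2]
    have t1 : (n : ℝ) ≤ (1 - y)⁻¹ := by
      rw [le_inv_comm₀ (by linarith) (by linarith)]; linarith [hy.1]
    have t2 : (1 - y)⁻¹ ≤ n + δ := by
      rw [inv_le_comm₀ (by linarith) (by linarith)]; linarith [hy.2]
    unfold peaks
    set t := (1 - y)⁻¹
    have ht : |Real.sin (Real.pi * t)| ≤ 4 * δ := by
      have : Real.pi * (t - n) = Real.pi * t - n * Real.pi := by ring
      have e : |Real.sin (Real.pi * t)| = |Real.sin (Real.pi * (t - n))| := by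
        rw [this, Real.sin_sub_nat_mul_pi, abs_mul]; simp
      rw [e]
      refine Real.abs_sin_le_abs.trans ?_
      rw [abs_of_nonneg (mul_nonneg Real.pi_pos.le (by linarith))]
      nlinarith [Real.pi_le_four, Real.pi_pos]
    have ht' : t ^ m * |Real.sin (Real.pi * t)| ≤ 1 / 4 := by
      calc t ^ m * |Real.sin (Real.pi * t)| ≤ s ^ m * (4 * δ) := by
            gcongr
            linarith
        _ = 1 / 4 := by rw [hδ]; field_simp; norm_num
    gcongr
    · linarith
    · exact le_max_of_le_right (by linarith [hy.1])
  have h_int : ∀ u v : ℝ, 0 ≤ u → u ≤ v → v ≤ x → IntervalIntegrable (peaks k m) volume u v :=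
    fun u v hu huv hv => ((continuousOn_peaks k m).mono fun y hy => by
      rw [uIcc_of_le huv] at hy
      constructor <;> linarith [hy.1, hy.2]).intervalIntegrable
  have hpos : ∀ u v : ℝ, u ≤ v → v ≤ x → 0 ≤ ∫ y in u..v, peaks k m y :=
    fun u v huv hv => intervalIntegral.integral_nonneg huv fun y hy =>
      peaks_nonneg k m (by linarith [hy.2])
  have hmid : (d - c) * ((s / 3) ^ k * (1 / 4)) ≤ ∫ y in c..d, peaks k m y := by
    have := intervalIntegral.integral_mono_on hcd (intervalIntegrable_const (μ := volume))
      (h_int c d (by linarith) hcd hdx) hlow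
    rwa [intervalIntegral.integral_const, smul_eq_mul] at this
  have hsplit : ∫ y in (0 : ℝ)..x, peaks k m y =
      (∫ y in (0 : ℝ)..c, peaks k m y) + (∫ y in c..d, peaks k m y) +
        ∫ y in d..x, peaks k m y := by
    rw [intervalIntegral.integral_add_adjacent_intervals,
      intervalIntegral.integral_add_adjacent_intervals] <;> apply h_int <;> linarith
  have e1 := hpos 0 c (by linarith) (by linarith)
  have e2 := hpos d x hdx le_rfl
  calc s ^ k / (3 ^ k * 64 * s ^ (m + 2)) = δ / s ^ 2 * ((s / 3) ^ k * (1 / 4)) := by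
        rw [hδ, div_pow]; field_simp; ring
    _ ≤ (d - c) * ((s / 3) ^ k * (1 / 4)) := by gcongr
    _ ≤ _ := by linarith

lemma jw_mul_phi_pow_le (a b : ℝ) (j : ℕ) {q : ℕ} (hq : |a| ≤ q) {x : ℝ}
    (hx : x ∈ Ioo (0 : ℝ) 1) :
    |jw a b x * phi x ^ j| ≤ 2 ^ |b| * (1 - x)⁻¹ ^ q := by
  obtain ⟨h0, h1⟩ := hx
  have hphi : |phi x ^ j| ≤ 1 := by
    rw [phi, abs_of_nonneg (pow_nonneg (Real.sqrt_nonneg _) _)]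
    exact pow_le_one₀ (Real.sqrt_nonneg _) (Real.sqrt_le_one.2 (by nlinarith))
  have hA : (1 - x) ^ a ≤ (1 - x)⁻¹ ^ q := by
    rw [← Real.rpow_natCast, Real.inv_rpow (by linarith), ← Real.rpow_neg (by linarith)]
    exact Real.rpow_le_rpow_of_exponent_ge (by linarith) (by linarith)
      (by linarith [neg_abs_le a])
  have hB : (1 + x) ^ b ≤ 2 ^ |b| :=
    (Real.rpow_le_rpow_of_exponent_le (by linarith) (le_abs_self b)).trans
      (Real.rpow_le_rpow (by linarith) (by linarith) (abs_nonneg b))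
  have hA0 : 0 ≤ (1 - x) ^ a := Real.rpow_nonneg (by linarith) _
  have hB0 : 0 ≤ (1 + x) ^ b := Real.rpow_nonneg (by linarith) _
  rw [abs_mul, jw, abs_of_nonneg (mul_nonneg hA0 hB0)]
  have hq0 : 0 ≤ (1 - x)⁻¹ ^ q := hA0.trans hA
  calc (1 - x) ^ a * (1 + x) ^ b * |phi x ^ j| ≤ (1 - x)⁻¹ ^ q * 2 ^ |b| * 1 := by gcongr
    _ = _ := by ring

lemma le_jw_mul_phi_pow (a b : ℝ) (j : ℕ) {q : ℕ} (hq : |a| ≤ q) {x : ℝ}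
    (hx : x ∈ Ioo (0 : ℝ) 1) :
    2 ^ (-|b|) / (1 - x)⁻¹ ^ (q + j) ≤ jw a b x * phi x ^ j := by
  obtain ⟨h0, h1⟩ := hx
  have hphi : (1 - x) ^ j ≤ phi x ^ j := by
    refine pow_le_pow_left₀ (by linarith) (Real.le_sqrt_of_sq_le (by nlinarith)) _
  have hA : (1 - x) ^ q ≤ (1 - x) ^ a := by
    rw [← Real.rpow_natCast]
    exact Real.rpow_le_rpow_of_exponent_ge (by linarith) (by linarith) (by linarith [le_abs_self a])
  have hB : 2 ^ (-|b|) ≤ (1 + x) ^ b := by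
    have h2 : (1 + x) ^ (-|b|) ≤ (1 + x) ^ b :=
      Real.rpow_le_rpow_of_exponent_le (by linarith) (neg_abs_le b)
    exact (Real.rpow_le_rpow_of_nonpos (by linarith) (by linarith)
      (by linarith [abs_nonneg b])).trans h2
  have hx0 : 0 ≤ 1 - x := by linarith
  calc 2 ^ (-|b|) / (1 - x)⁻¹ ^ (q + j) = (1 - x) ^ q * 2 ^ (-|b|) * (1 - x) ^ j := by
        rw [inv_pow, div_inv_eq_mul, pow_add]; ring
    _ ≤ (1 - x) ^ a * (1 + x) ^ b * phi x ^ j := by gcongr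

lemma lintegral_peaks_lt_top {P C : ℝ} (hP : 0 < P) (hC : 0 ≤ C) {k m q : ℕ}
    (hm : (q + k) * P + 2 ≤ m) {v : ℝ → ℝ}
    (hv : ∀ x ∈ Ioo (0 : ℝ) 1, |v x| ≤ C * (1 - x)⁻¹ ^ q) :
    ∫⁻ x in Ioo (-1 : ℝ) 1, ‖v x * peaks k m x‖ₑ ^ P < ⊤ := by
  set K : ℕ → ℝ := fun n => (C * (2 * n) ^ (q + k)) ^ P
  set δ : ℕ → ℝ := fun n => 2 ^ m / n ^ m
  set S : ℕ → Set ℝ := fun n => Icc (1 - (n : ℝ)⁻¹ - δ n) (1 - (n : ℝ)⁻¹ + δ n)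
  have hbound : ∀ x ∈ Ioo (-1 : ℝ) 1, ‖v x * peaks k m x‖ₑ ^ P ≤
      ∑' n, (S n).indicator (fun _ => ENNReal.ofReal (K n)) x := by
    intro x hx
    by_cases hz : peaks k m x = 0
    · simp [hz, hP]
    have hs0 : 0 < (1 - x)⁻¹ := inv_pos.2 (by linarith [hx.2])
    have hlt : (1 - x)⁻¹ ^ m * |Real.sin (Real.pi * (1 - x)⁻¹)| < x := by
      by_contra! hcon
      exact hz (by rw [peaks, max_eq_left (by linarith), mul_zero])
    have hx0 : 0 < x := lt_of_le_of_lt (by positivity) hlt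
    have hs1 : 1 ≤ (1 - x)⁻¹ := one_le_inv_iff₀.2 ⟨by linarith [hx.2], by linarith⟩
    have hpk : |peaks k m x| ≤ (1 - x)⁻¹ ^ k := by
      rw [abs_of_nonneg (peaks_nonneg k m hx.2), peaks]
      refine mul_le_of_le_one_right (by positivity) (max_le zero_le_one ?_)
      have : 0 ≤ (1 - x)⁻¹ ^ m * |Real.sin (Real.pi * (1 - x)⁻¹)| := by positivity
      linarith [hx.2]
    have hvx := hv x ⟨hx0, hx.2⟩
    have hxs : x = 1 - (1 - x)⁻¹⁻¹ := by rw [inv_inv]; ring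
    obtain ⟨n, hn1, hn2, hn3, hn4⟩ := exists_nat_abs_sub_le_sin hs1
    set s := (1 - x)⁻¹
    have hn1' : (1 : ℝ) ≤ n := by exact_mod_cast hn1
    have hn0 : (0 : ℝ) < n := by linarith
    have hsn : |s - n| ≤ δ n := by
      have h1 : s ^ m * |s - n| ≤ 1 :=
        (mul_le_mul_of_nonneg_left hn4 (by positivity)).trans (by linarith [hx.2])
      have h2 : (n : ℝ) ^ m ≤ 2 ^ m * s ^ m := by
        rw [← mul_pow]; gcongr
      rw [le_div_iff₀ (by positivity)]
      calc |s - n| * (n : ℝ) ^ m ≤ |s - n| * (2 ^ m * s ^ m) := by gcongr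
        _ = 2 ^ m * (s ^ m * |s - n|) := by ring
        _ ≤ 2 ^ m * 1 := by gcongr
        _ = 2 ^ m := mul_one _
    have hxn : |s⁻¹ - (n : ℝ)⁻¹| ≤ δ n := by
      refine le_trans ?_ hsn
      have : s⁻¹ - (n : ℝ)⁻¹ = (n - s) / (s * n) := by field_simp
      rw [this, abs_div, abs_sub_comm, abs_of_pos (by positivity : 0 < s * n)]
      exact div_le_self (abs_nonneg _) (by nlinarith)
    have hmem : x ∈ S n := by
      have := abs_le.1 hxn
      constructor <;> linarith [this.1, this.2]
    refine le_trans ?_ (ENNReal.le_tsum n)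
    rw [indicator_of_mem hmem, Real.enorm_eq_ofReal_abs, ENNReal.ofReal_rpow_of_nonneg
      (abs_nonneg _) hP.le]
    refine ENNReal.ofReal_le_ofReal (Real.rpow_le_rpow (abs_nonneg _) ?_ hP.le)
    rw [abs_mul]
    calc |v x| * |peaks k m x| ≤ C * s ^ q * s ^ k := by gcongr
      _ = C * s ^ (q + k) := by ring
      _ ≤ C * (2 * n) ^ (q + k) := by gcongr
  have hsum : Summable fun n : ℕ => K n * (2 * δ n) := by
    have h1 : Summable fun n : ℕ => (n : ℝ) ^ ((q + k) * P - m) :=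
      Real.summable_nat_rpow.2 (by linarith)
    have h2 := h1.mul_left (C ^ P * (2 ^ (q + k)) ^ P * (2 * 2 ^ m))
    refine Summable.congr_cofinite h2 ?_
    filter_upwards [(Set.finite_singleton (0 : ℕ)).compl_mem_cofinite] with n hn
    have hn0 : (0 : ℝ) < n := by
      have : n ≠ 0 := by simpa using hn
      positivity
    simp only [K, δ]
    rw [Real.mul_rpow hC (by positivity), mul_pow, Real.mul_rpow (by positivity) (by positivity),
      Real.rpow_sub hn0, Real.rpow_natCast, Real.rpow_mul hn0.le]
    have : ((n : ℝ) ^ ((q : ℝ) + k)) = n ^ (q + k) := by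
      rw [← Real.rpow_natCast]; push_cast; rfl
    rw [this]; ring
  calc ∫⁻ x in Ioo (-1 : ℝ) 1, ‖v x * peaks k m x‖ₑ ^ P
      ≤ ∫⁻ x in Ioo (-1 : ℝ) 1, ∑' n, (S n).indicator (fun _ => ENNReal.ofReal (K n)) x :=
        setLIntegral_mono' measurableSet_Ioo hbound
    _ ≤ ∫⁻ x, ∑' n, (S n).indicator (fun _ => ENNReal.ofReal (K n)) x :=
        setLIntegral_le_lintegral _ _
    _ = ∑' n, ∫⁻ x, (S n).indicator (fun _ => ENNReal.ofReal (K n)) x :=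
        lintegral_tsum fun n => (measurable_const.indicator measurableSet_Icc).aemeasurable
    _ = ∑' n, ENNReal.ofReal (K n * (2 * δ n)) := by
        refine tsum_congr fun n => ?_
        rw [lintegral_indicator_const measurableSet_Icc, Real.volume_Icc,
          ENNReal.ofReal_mul (Real.rpow_nonneg (by positivity) _)]
        congr 2
        ring
    _ < ⊤ := hsum.tsum_ofReal_lt_top

lemma lintegral_inv_one_sub_eq_top {c : ℝ} (hc : 0 < c) :
    ∫⁻ x in Ioo (2 / 3 : ℝ) 1, ENNReal.ofReal (c * (1 - x)⁻¹) = ⊤ := by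
  by_contra hne
  have hmeas : Measurable fun x : ℝ => c * (1 - x)⁻¹ := by fun_prop
  have h_int : IntegrableOn (fun x : ℝ => c * (1 - x)⁻¹) (Ioo (2 / 3) 1) := by
    refine ⟨hmeas.aestronglyMeasurable, ?_⟩
    rw [hasFiniteIntegral_iff_ofReal]
    · exact lt_top_iff_ne_top.2 hne
    · filter_upwards [ae_restrict_mem measurableSet_Ioo] with x hx
      exact mul_nonneg hc.le (inv_nonneg.2 (by linarith [hx.2]))
  have h2 : IntervalIntegrable (fun x : ℝ => (x - 1)⁻¹) volume (2 / 3) 1 := by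
    rw [intervalIntegrable_iff_integrableOn_Ioo_of_le (by norm_num)]
    refine (h_int.const_mul (-c⁻¹)).congr (ae_of_all _ fun x => ?_)
    have hx : (x - 1)⁻¹ = -(1 - x)⁻¹ := by rw [← inv_neg, neg_sub]
    simp only [hx]
    field_simp
  rw [intervalIntegrable_sub_inv_iff] at h2
  norm_num at h2

theorem stmt8 (r : ℕ) (a b : ℝ) (p : ℝ≥0∞) (hp0 : 0 < p) (hp1 : p < 1) :
    ∃ f : ℝ → ℝ, MemB p (r + 1) a b f ∧
      Jnorm p (fun x => jw a b x * phi x ^ r * iteratedDeriv r f x) (Icc (-1) 1) = ⊤ := by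
  have hptop : p ≠ ⊤ := (hp1.trans ENNReal.one_lt_top).ne
  set P := p.toReal with hPdef
  have hP0 : 0 < P := ENNReal.toReal_pos hp0.ne' hptop
  have hP1 : P < 1 := by
    simpa using (ENNReal.toReal_lt_toReal hptop ENNReal.one_ne_top).2 hp1
  obtain ⟨q, hq⟩ := exists_nat_ge |a|
  obtain ⟨e, he⟩ := exists_nat_ge (1 / P)
  obtain ⟨m, hm⟩ := exists_nat_ge (((q + (q + r + e + 2)) * P + 2) / (1 - P))
  set k := m + (q + r + e + 2) with hk
  have hmk : ((q : ℝ) + k) * P + 2 ≤ m := by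
    rw [div_le_iff₀ (by linarith)] at hm
    rw [hk]; push_cast; linarith
  have heP : 1 ≤ e * P := by rwa [div_le_iff₀ hP0] at he
  have hderiv : ∀ x ∈ Ioo (-1 : ℝ) 1,
      HasDerivAt (fun y => ∫ u in (0 : ℝ)..y, peaks k m u) (peaks k m x) x :=
    fun x hx => hasDerivAt_integral_of_continuousOn_Ioo (continuousOn_peaks k m) hx
  obtain ⟨f, hf⟩ := exists_iteratedDeriv_eq_on_Ioo r
    (fun x hx => (hderiv x hx).continuousAt.continuousWithinAt)
  have hfderiv : ∀ x ∈ Ioo (-1 : ℝ) 1, HasDerivAt (iteratedDeriv r f) (peaks k m x) x := by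
    intro x hx
    refine (hderiv x hx).congr_of_eventuallyEq ?_
    filter_upwards [isOpen_Ioo.mem_nhds hx] with y hy using hf y hy
  refine ⟨f, ⟨fun _ => ?_, ?_⟩, ?_⟩
  · rw [Nat.add_sub_cancel]
    intro c d hc hcd hd
    have hsub : Icc c d ⊆ Ioo (-1 : ℝ) 1 := Icc_subset_Ioo hc hd
    have hcont : ContinuousOn (deriv (iteratedDeriv r f)) (Icc c d) :=
      ((continuousOn_peaks k m).mono hsub).congr fun x hx => (hfderiv x (hsub hx)).deriv
    refine ⟨hcont.integrableOn_Icc, fun x hx => ?_⟩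
    have hux : uIcc c x ⊆ Icc c d := by
      rw [uIcc_of_le hx.1]; exact Icc_subset_Icc_right hx.2
    rw [intervalIntegral.integral_deriv_eq_sub
      (fun y hy => (hfderiv y (hsub (hux hy))).differentiableAt)
      (hcont.mono hux).intervalIntegrable]
    ring
  · rw [Jnorm, eLpNorm_lt_top_iff_lintegral_rpow_enorm_lt_top hp0.ne' hptop,
      ← Measure.restrict_congr_set Ioo_ae_eq_Icc]
    rw [setLIntegral_congr_fun (g := fun x => ‖jw a b x * phi x ^ (r + 1) * peaks k m x‖ₑ ^ P)
      measurableSet_Ioo fun x hx => by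
        simp only [iteratedDeriv_succ, (hfderiv x hx).deriv, hPdef]]
    exact lintegral_peaks_lt_top hP0 (Real.rpow_nonneg zero_le_two _) hmk
      fun x hx => jw_mul_phi_pow_le a b (r + 1) hq hx
  · by_contra hne
    have hlt := (eLpNorm_lt_top_iff_lintegral_rpow_enorm_lt_top hp0.ne' hptop).1
      (lt_top_iff_ne_top.2 hne)
    set c : ℝ := 2 ^ (-|b|) / (3 ^ k * 64) with hcdef
    have hc : 0 < c := by positivity
    refine hlt.not_ge ?_
    rw [← lintegral_inv_one_sub_eq_top (Real.rpow_pos_of_pos hc P)]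
    have hsub : Ioo (2 / 3 : ℝ) 1 ⊆ Icc (-1) 1 :=
      Ioo_subset_Icc_self.trans (Icc_subset_Icc (by norm_num) le_rfl)
    refine le_trans ?_ (lintegral_mono_set hsub)
    refine setLIntegral_mono' measurableSet_Ioo fun x hx => ?_
    have hx0 : x ∈ Ioo (0 : ℝ) 1 := ⟨by linarith [hx.1], hx.2⟩
    have h1 := le_jw_mul_phi_pow a b r hq hx0
    have h2 := le_integral_peaks k m hx
    rw [hf x ⟨by linarith [hx.1], hx.2⟩, Real.enorm_eq_ofReal_abs,
      ENNReal.ofReal_rpow_of_nonneg (abs_nonneg _) hP0.le]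
    have hs1 : 1 ≤ (1 - x)⁻¹ := one_le_inv_iff₀.2 ⟨by linarith [hx.2], by linarith [hx.1]⟩
    set s := (1 - x)⁻¹
    have hs0 : 0 < s := by linarith
    have h3 : c * s ^ e ≤ |jw a b x * phi x ^ r * ∫ u in (0 : ℝ)..x, peaks k m u| := by
      refine le_trans ?_ (le_abs_self _)
      calc c * s ^ e = 2 ^ (-|b|) / s ^ (q + r) * (s ^ k / (3 ^ k * 64 * s ^ (m + 2))) := by
            rw [hcdef]; nth_rewrite 2 [hk]; field_simp; ring
        _ ≤ _ := mul_le_mul h1 h2 (by positivity) (le_trans (by positivity) h1)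
    refine ENNReal.ofReal_le_ofReal (le_trans ?_ (Real.rpow_le_rpow (by positivity) h3 hP0.le))
    rw [Real.mul_rpow hc.le (by positivity), ← Real.rpow_natCast, ← Real.rpow_mul hs0.le]
    gcongr
    simpa using Real.rpow_le_rpow_of_exponent_le hs1 heP

end
end

section
/- Suppose k∈ℕ, r∈ℕ₀, α∈ℝ, 0<p<∞, and r/2+β<0; in the case 0<p<1 and r≥1 assume additionally that r/2+β<1−1/p. Then there exists a function f∈B_p^r(w_{α,β}) such that ω_{k,r}^φ(f^{(r)},t)_{α,β,p}=∞ for all t>0. -/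
open MeasureTheory Set Filter Topology
open scoped ENNReal NNReal

noncomputable section

/-- The one-sided power `z₊^e` multiplied by `χ`. -/
def truncPow (e : ℝ) (χ : ℝ → ℝ) (z : ℝ) : ℝ := if 0 < z then z ^ e * χ z else 0

lemma truncPow_of_nonpos (e : ℝ) (χ : ℝ → ℝ) {z : ℝ} (hz : z ≤ 0) : truncPow e χ z = 0 :=
  if_neg hz.not_gt

lemma truncPow_of_pos (e : ℝ) (χ : ℝ → ℝ) {z : ℝ} (hz : 0 < z) :
    truncPow e χ z = z ^ e * χ z := if_pos hz

lemma measurable_truncPow (e : ℝ) {χ : ℝ → ℝ} (hχ : Continuous χ) :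
    Measurable (truncPow e χ) :=
  Measurable.ite measurableSet_Ioi ((measurable_id.pow_const e).mul hχ.measurable)
    measurable_const

lemma continuous_truncPow {e : ℝ} (he : 0 < e) {χ : ℝ → ℝ} (hχ : Continuous χ) :
    Continuous (truncPow e χ) := by
  have h : truncPow e χ = fun z => max z 0 ^ e * χ z := by
    funext z
    rcases lt_or_ge 0 z with hz | hz
    · rw [truncPow_of_pos e χ hz, max_eq_left hz.le]
    · rw [truncPow_of_nonpos e χ hz, max_eq_right hz, Real.zero_rpow he.ne', zero_mul]
  rw [h]
  exact ((continuous_id.max continuous_const).rpow_const fun _ => Or.inr he.le).mul hχ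

lemma hasDerivAt_truncPow {e : ℝ} {χ : ℝ → ℝ} (hχ : Differentiable ℝ χ) {z : ℝ}
    (hz : z ≠ 0 ∨ 1 < e) :
    HasDerivAt (truncPow e χ) (truncPow (e - 1) (fun x => e * χ x + x * deriv χ x) z) z := by
  rcases lt_trichotomy z 0 with h | h | h
  · rw [truncPow_of_nonpos _ _ h.le]
    refine (hasDerivAt_const z (0 : ℝ)).congr_of_eventuallyEq ?_
    filter_upwards [Iio_mem_nhds h] with x hx
    exact truncPow_of_nonpos e χ (le_of_lt hx)
  · have he : 1 < e := hz.resolve_left (not_not.mpr h)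
    subst h
    rw [truncPow_of_nonpos _ _ le_rfl, ← hasDerivWithinAt_univ, ← Iic_union_Ici (a := (0 : ℝ))]
    refine HasDerivWithinAt.union ?_ ?_
    · exact (hasDerivWithinAt_const (0 : ℝ) (Iic 0) (0 : ℝ)).congr
        (fun x hx => truncPow_of_nonpos e χ hx) (truncPow_of_nonpos e χ le_rfl)
    · have hmul := (Real.hasDerivAt_rpow_const (x := 0) (p := e) (Or.inr he.le)).mul
        (hχ 0).hasDerivAt
      rw [Real.zero_rpow (by linarith), Real.zero_rpow (by linarith)] at hmul
      simp only [mul_zero, zero_mul, add_zero] at hmul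
      refine hmul.hasDerivWithinAt.congr (fun x hx => ?_) ?_
      · rcases (mem_Ici.mp hx).eq_or_lt with h0 | h0
        · simp [truncPow, ← h0, Real.zero_rpow (by linarith : e ≠ 0)]
        · exact truncPow_of_pos e χ h0
      · simp [truncPow, Real.zero_rpow (by linarith : e ≠ 0)]
  · have hmul := (Real.hasDerivAt_rpow_const (x := z) (p := e) (Or.inl h.ne')).mul
        (hχ z).hasDerivAt
    have heq : truncPow (e - 1) (fun x => e * χ x + x * deriv χ x) z
        = e * z ^ (e - 1) * χ z + z ^ e * deriv χ z := by
      have : z ^ e = z ^ (e - 1) * z := by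
        rw [← Real.rpow_add_one h.ne', sub_add_cancel]
      rw [truncPow_of_pos _ _ h, this]
      ring
    rw [heq]
    refine hmul.congr_of_eventuallyEq ?_
    filter_upwards [Ioi_mem_nhds h] with x hx
    exact truncPow_of_pos e χ hx

lemma integrableOn_truncPow {e : ℝ} (he : -1 < e) {χ : ℝ → ℝ} (hχ : Continuous χ) (A B : ℝ) :
    IntegrableOn (truncPow e χ) (Icc A B) := by
  rcases le_or_gt A B with hAB | hAB
  · have h := ((intervalIntegral.intervalIntegrable_rpow' (a := A) (b := B) he).mul_continuousOn
      hχ.continuousOn)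
    rw [intervalIntegrable_iff_integrableOn_Icc_of_le hAB] at h
    exact h.indicator measurableSet_Ioi
  · simp [Icc_eq_empty hAB.not_ge]

lemma integrableOn_truncPow_comp {e : ℝ} (he : -1 < e) {χ : ℝ → ℝ} (hχ : Continuous χ)
    {m : ℝ} (hm : 0 < m) {A B : ℝ} (hAB : A ≤ B) :
    IntegrableOn (fun y => truncPow e χ (m * (1 + y) - 1)) (Icc A B) := by
  have h : IntervalIntegrable (truncPow e χ) volume (m * A + (m - 1)) (m * B + (m - 1)) := by
    rw [intervalIntegrable_iff_integrableOn_Icc_of_le (by gcongr)]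
    exact integrableOn_truncPow he hχ _ _
  have h2 := (h.comp_add_right (m - 1)).comp_mul_left (c := m)
  rw [add_sub_cancel_right, add_sub_cancel_right, mul_div_cancel_left₀ _ hm.ne',
    mul_div_cancel_left₀ _ hm.ne', intervalIntegrable_iff_integrableOn_Icc_of_le hAB] at h2
  have h3 : ∀ y, m * (1 + y) - 1 = m * y + (m - 1) := fun y => by ring
  simpa only [h3] using h2

/-- The successive cutoff factors in the derivatives of `z₊^E χ`. -/
def cutoffSeq (E : ℝ) (χ : ℝ → ℝ) : ℕ → ℝ → ℝ
  | 0 => χ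
  | j + 1 => fun z => (E - j) * cutoffSeq E χ j z + z * deriv (cutoffSeq E χ j) z

/-- `χ` is smooth, equal to `κ` left of `1/4`, and zero right of `1/2`. -/
structure IsCutoff (χ : ℝ → ℝ) (κ : ℝ) : Prop where
  smooth : ContDiff ℝ (⊤ : ℕ∞) χ
  left : ∀ z < 1 / 4, χ z = κ
  right : ∀ z, 1 / 2 < z → χ z = 0

lemma IsCutoff.step {χ : ℝ → ℝ} {κ : ℝ} (h : IsCutoff χ κ) (e : ℝ) :
    IsCutoff (fun z => e * χ z + z * deriv χ z) (e * κ) where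
  smooth := by
    have hd : ContDiff ℝ (⊤ : ℕ∞) (deriv χ) := (contDiff_infty_iff_deriv.mp h.smooth).2
    exact (contDiff_const.mul h.smooth).add (contDiff_id.mul hd)
  left z hz := by
    have : χ =ᶠ[𝓝 z] fun _ => κ := by
      filter_upwards [Iio_mem_nhds hz] with x hx using h.left x hx
    simp [this.deriv_eq, h.left z hz]
  right z hz := by
    have : χ =ᶠ[𝓝 z] fun _ => 0 := by
      filter_upwards [Ioi_mem_nhds hz] with x hx using h.right x hx
    simp [this.deriv_eq, h.right z hz]

lemma IsCutoff.exists_cutoffSeq {χ : ℝ → ℝ} (h : IsCutoff χ 1) (E : ℝ) (j : ℕ)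
    (hE : ∀ i < j, 0 < E - i) : ∃ κ > 0, IsCutoff (cutoffSeq E χ j) κ := by
  induction j with
  | zero => exact ⟨1, one_pos, h⟩
  | succ j ih =>
    obtain ⟨κ, hκ, hc⟩ := ih fun i hi => hE i (by omega)
    exact ⟨(E - j) * κ, mul_pos (hE j (by omega)) hκ, hc.step (E - j)⟩

lemma exists_isCutoff : ∃ χ : ℝ → ℝ, IsCutoff χ 1 := by
  refine ⟨fun z => Real.smoothTransition (2 - 4 * z), ?_, fun z hz => ?_, fun z hz => ?_⟩
  · exact Real.smoothTransition.contDiff.comp (contDiff_const.sub (contDiff_const.mul contDiff_id))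
  · exact Real.smoothTransition.one_of_one_le (by linarith)
  · exact Real.smoothTransition.zero_of_nonpos (by linarith)

/-- The lacunary superposition `∑ cₙ H(Mⁿ⁺¹(1+y) - 1)` of rescaled copies of `H`. -/
def lacSum (M : ℝ) (c : ℕ → ℝ) (H : ℝ → ℝ) (y : ℝ) : ℝ :=
  ∑' n, c n * H (M ^ (n + 1) * (1 + y) - 1)

/-- The point `1 + y = v` can only meet the bump of index `N`. -/
def Isolates (M : ℝ) (N : ℕ) (v : ℝ) : Prop :=
  (N = 0 ∨ M ^ N * v < 1) ∧ 3 / 2 < M ^ (N + 2) * v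

lemma Isolates.pos {M : ℝ} (hM : 8 ≤ M) {N : ℕ} {v : ℝ} (h : Isolates M N v) : 0 < v :=
  pos_of_mul_pos_right (lt_trans (by norm_num) h.2) (by positivity)

lemma Isolates.eventually {M : ℝ} {N : ℕ} {y : ℝ} (h : Isolates M N (1 + y)) :
    ∀ᶠ x in 𝓝 y, Isolates M N (1 + x) := by
  have h2 : ∀ᶠ x in 𝓝 y, 3 / 2 < M ^ (N + 2) * (1 + x) :=
    (by fun_prop : Continuous fun x : ℝ => M ^ (N + 2) * (1 + x)).continuousAt.eventually
      (lt_mem_nhds h.2)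
  rcases h.1 with h0 | h1
  · filter_upwards [h2] with x hx using ⟨Or.inl h0, hx⟩
  · have h1 : ∀ᶠ x in 𝓝 y, M ^ N * (1 + x) < 1 :=
      (by fun_prop : Continuous fun x : ℝ => M ^ N * (1 + x)).continuousAt.eventually
        (gt_mem_nhds h1)
    filter_upwards [h1, h2] with x hx1 hx2 using ⟨Or.inr hx1, hx2⟩

lemma exists_isolates {M : ℝ} (hM : 8 ≤ M) {v : ℝ} (hv : 0 < v) : ∃ N, Isolates M N v := by
  classical
  have hex : ∃ n : ℕ, 1 / 2 ≤ M ^ (n + 1) * v := by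
    obtain ⟨n, hn⟩ := pow_unbounded_of_one_lt (1 / v) (by linarith : 1 < M)
    refine ⟨n, ?_⟩
    rw [div_lt_iff₀ hv] at hn
    have : M ^ n * v ≤ M ^ (n + 1) * v := by
      gcongr
      · linarith
      · omega
    linarith
  refine ⟨Nat.find hex, ?_, ?_⟩
  · rcases Nat.eq_zero_or_pos (Nat.find hex) with h | h
    · exact Or.inl h
    · right
      have := Nat.find_min hex (m := Nat.find hex - 1) (by omega)
      rw [Nat.sub_add_cancel h] at this
      linarith
  · have := Nat.find_spec hex
    rw [pow_succ']
    nlinarith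

lemma Isolates.lacSum_eq {M : ℝ} (hM : 8 ≤ M) {N : ℕ} {y : ℝ} (h : Isolates M N (1 + y))
    (c : ℕ → ℝ) {H : ℝ → ℝ} (hH0 : ∀ z ≤ 0, H z = 0) (hH1 : ∀ z, 1 / 2 < z → H z = 0) :
    lacSum M c H y = c N * H (M ^ (N + 1) * (1 + y) - 1) := by
  have hv := h.pos hM
  refine tsum_eq_single N fun n hn => ?_
  rcases lt_or_gt_of_ne hn with hlt | hgt
  · rcases h.1 with h0 | h1
    · omega
    · have : M ^ (n + 1) * (1 + y) ≤ M ^ N * (1 + y) := by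
        gcongr
        · linarith
        · omega
      rw [hH0 _ (by linarith), mul_zero]
  · have : M ^ (N + 2) * (1 + y) ≤ M ^ (n + 1) * (1 + y) :=
      mul_le_mul_of_nonneg_right (pow_le_pow_right₀ (by linarith) (by omega)) hv.le
    rw [hH1 _ (by linarith [h.2]), mul_zero]

lemma lacSum_eq_zero_of_gap {M : ℝ} (hM : 8 ≤ M) {N : ℕ} {y : ℝ} (h1 : M ^ N * (1 + y) < 1)
    (h2 : 3 / 2 < M ^ (N + 1) * (1 + y)) (c : ℕ → ℝ) {H : ℝ → ℝ} (hH0 : ∀ z ≤ 0, H z = 0)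
    (hH1 : ∀ z, 1 / 2 < z → H z = 0) : lacSum M c H y = 0 := by
  have hiso : Isolates M N (1 + y) := ⟨Or.inr h1, by rw [pow_succ']; nlinarith⟩
  rw [hiso.lacSum_eq hM c hH0 hH1, hH1 _ (by linarith), mul_zero]

lemma ne_one_of_gap {M : ℝ} (hM : 8 ≤ M) {N : ℕ} {v : ℝ} (h1 : M ^ N * v < 1)
    (h2 : 3 / 2 < M ^ (N + 1) * v) (n : ℕ) : M ^ n * v ≠ 1 := by
  have hv : 0 < v := pos_of_mul_pos_right (lt_trans (by norm_num) h2) (by positivity)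
  rcases le_or_gt n N with hn | hn
  · have : M ^ n * v ≤ M ^ N * v := by
      gcongr
      linarith
    linarith
  · have : M ^ (N + 1) * v ≤ M ^ n * v := by
      gcongr
      · linarith
      · omega
    linarith

section Derivatives

variable {M E : ℝ} {c : ℕ → ℝ} {χ : ℝ → ℝ}

/-- The formal `j`-th derivative of `lacSum M c (truncPow E χ)`. -/
def lacDeriv (M E : ℝ) (c : ℕ → ℝ) (χ : ℝ → ℝ) (j : ℕ) : ℝ → ℝ :=
  lacSum M (fun n => c n * (M ^ (n + 1)) ^ j) (truncPow (E - j) (cutoffSeq E χ j))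

lemma truncPow_eq_zero_of_cutoff {e κ : ℝ} (h : IsCutoff χ κ) {z : ℝ} (hz : 1 / 2 < z) :
    truncPow e χ z = 0 := by
  rw [truncPow_of_pos _ _ (by linarith), h.right z hz, mul_zero]

lemma IsCutoff.cutoffSeq (h : IsCutoff χ 1) (E : ℝ) (j : ℕ) :
    ∃ κ, IsCutoff (cutoffSeq E χ j) κ := by
  induction j with
  | zero => exact ⟨1, h⟩
  | succ j ih =>
    obtain ⟨κ, hc⟩ := ih
    exact ⟨(E - j) * κ, hc.step (E - j)⟩

lemma IsCutoff.continuous_cutoffSeq (h : IsCutoff χ 1) (E : ℝ) (j : ℕ) :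
    Continuous (_root_.cutoffSeq E χ j) :=
  (h.cutoffSeq E j).choose_spec.smooth.continuous

lemma Isolates.lacDeriv_eq (hM : 8 ≤ M) (h : IsCutoff χ 1) {N : ℕ} {y : ℝ}
    (hN : Isolates M N (1 + y)) (j : ℕ) :
    lacDeriv M E c χ j y = c N * (M ^ (N + 1)) ^ j *
      truncPow (E - j) (cutoffSeq E χ j) (M ^ (N + 1) * (1 + y) - 1) := by
  obtain ⟨κ, hκ⟩ := h.cutoffSeq E j
  exact hN.lacSum_eq hM _ (fun z hz => truncPow_of_nonpos _ _ hz)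
    fun z hz => truncPow_eq_zero_of_cutoff hκ hz

lemma hasDerivAt_lacDeriv (hM : 8 ≤ M) (h : IsCutoff χ 1) {y : ℝ} (hy : -1 < y) {j : ℕ}
    (hj : (∀ n, M ^ (n + 1) * (1 + y) ≠ 1) ∨ 1 < E - j) :
    HasDerivAt (lacDeriv M E c χ j) (lacDeriv M E c χ (j + 1) y) y := by
  obtain ⟨N, hN⟩ := exists_isolates hM (by linarith : 0 < 1 + y)
  obtain ⟨κ, hκ⟩ := h.cutoffSeq E j
  have hd : Differentiable ℝ (cutoffSeq E χ j) :=
    hκ.smooth.differentiable (by simp)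
  have hz : M ^ (N + 1) * (1 + y) - 1 ≠ 0 ∨ 1 < E - j :=
    hj.imp (fun h => sub_ne_zero.mpr (h N)) id
  have haff : HasDerivAt (fun x : ℝ => M ^ (N + 1) * (1 + x) - 1) (M ^ (N + 1)) y := by
    simpa using (((hasDerivAt_id y).const_add 1).const_mul (M ^ (N + 1))).sub_const 1
  have hcomp := (((hasDerivAt_truncPow hd hz).comp y haff).const_mul
    (c N * (M ^ (N + 1)) ^ j))
  rw [hN.lacDeriv_eq hM h (j + 1)]
  have hval : c N * (M ^ (N + 1)) ^ (j + 1) *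
      truncPow (E - ↑(j + 1)) (cutoffSeq E χ (j + 1)) (M ^ (N + 1) * (1 + y) - 1) =
      c N * (M ^ (N + 1)) ^ j * (truncPow (E - j - 1)
        (fun x => (E - j) * cutoffSeq E χ j x + x * deriv (cutoffSeq E χ j) x)
        (M ^ (N + 1) * (1 + y) - 1) * M ^ (N + 1)) := by
    have he : E - ((j + 1 : ℕ) : ℝ) = E - j - 1 := by push_cast; ring
    rw [he]
    change _ * truncPow _ (fun x => (E - j) * cutoffSeq E χ j x + x * deriv (cutoffSeq E χ j) x) _
      = _
    ring
  rw [hval]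
  refine hcomp.congr_of_eventuallyEq ?_
  filter_upwards [hN.eventually] with x hx using hx.lacDeriv_eq hM h j

lemma continuousAt_lacDeriv (hM : 8 ≤ M) (h : IsCutoff χ 1) {y : ℝ} (hy : -1 < y) {j : ℕ}
    (hj : 0 < E - j) : ContinuousAt (lacDeriv M E c χ j) y := by
  obtain ⟨N, hN⟩ := exists_isolates hM (by linarith : 0 < 1 + y)
  have hc := continuous_truncPow hj (h.continuous_cutoffSeq E j)
  refine ContinuousAt.congr (f := fun x => c N * (M ^ (N + 1)) ^ j *
      truncPow (E - j) (cutoffSeq E χ j) (M ^ (N + 1) * (1 + x) - 1)) (by fun_prop) ?_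
  filter_upwards [hN.eventually] with x hx using (hx.lacDeriv_eq hM h j).symm

lemma integrableOn_lacDeriv (hM : 8 ≤ M) (h : IsCutoff χ 1) {A B : ℝ} (hA : -1 < A) {j : ℕ}
    (hj : -1 < E - j) : IntegrableOn (lacDeriv M E c χ j) (Icc A B) := by
  refine LocallyIntegrableOn.integrableOn_isCompact (fun y hy => ?_) isCompact_Icc
  obtain ⟨N, hN⟩ := exists_isolates hM (by linarith [hy.1] : 0 < 1 + y)
  obtain ⟨ε, hε, hball⟩ := Metric.eventually_nhds_iff_ball.mp hN.eventually
  refine ⟨Icc (y - ε / 2) (y + ε / 2), mem_nhdsWithin_of_mem_nhds (Icc_mem_nhds (by linarith)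
    (by linarith)), ?_⟩
  have hi := (integrableOn_truncPow_comp hj (h.continuous_cutoffSeq E j)
    (by positivity : 0 < M ^ (N + 1)) (by linarith : y - ε / 2 ≤ y + ε / 2)).const_mul
      (c N * (M ^ (N + 1)) ^ j)
  refine IntegrableOn.congr_fun hi (fun x hx => ?_) measurableSet_Icc
  refine ((hball x ?_).lacDeriv_eq hM h j).symm
  rw [Metric.mem_ball, Real.dist_eq, abs_lt]
  constructor <;> linarith [hx.1, hx.2]

lemma iteratedDeriv_lacDeriv_of_lt (hM : 8 ≤ M) (h : IsCutoff χ 1) {r j : ℕ} (hj : j < r)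
    (hE : (r : ℝ) - 1 < E) {y : ℝ} (hy : -1 < y) :
    iteratedDeriv j (lacDeriv M E c χ 0) y = lacDeriv M E c χ j y := by
  induction j generalizing y with
  | zero => simp
  | succ j ih =>
    have hloc : iteratedDeriv j (lacDeriv M E c χ 0) =ᶠ[𝓝 y] lacDeriv M E c χ j := by
      filter_upwards [Ioi_mem_nhds hy] with x hx using ih (by omega) hx
    have hjr : (j : ℝ) + 2 ≤ r := by exact_mod_cast hj
    rw [iteratedDeriv_succ, hloc.deriv_eq]
    exact (hasDerivAt_lacDeriv hM h hy (Or.inr (by linarith))).deriv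

lemma iteratedDeriv_lacDeriv (hM : 8 ≤ M) (h : IsCutoff χ 1) {r : ℕ}
    (hE : 1 ≤ r → (r : ℝ) - 1 < E) {y : ℝ} (hy : -1 < y)
    (hne : ∀ n, M ^ (n + 1) * (1 + y) ≠ 1) :
    iteratedDeriv r (lacDeriv M E c χ 0) y = lacDeriv M E c χ r y := by
  rcases r with _ | r
  · simp
  · have hloc : iteratedDeriv r (lacDeriv M E c χ 0) =ᶠ[𝓝 y] lacDeriv M E c χ r := by
      filter_upwards [Ioi_mem_nhds hy] with x hx using
        iteratedDeriv_lacDeriv_of_lt hM h (Nat.lt_succ_self r) (hE (by omega)) hx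
    rw [iteratedDeriv_succ, hloc.deriv_eq]
    exact (hasDerivAt_lacDeriv hM h hy (Or.inl hne)).deriv

lemma countable_setOf_pow_mul_eq_one (M : ℝ) :
    {y : ℝ | ∃ n : ℕ, M ^ (n + 1) * (1 + y) = 1}.Countable := by
  refine (countable_range fun n : ℕ => (M ^ (n + 1))⁻¹ - 1).mono ?_
  rintro y ⟨n, hn⟩
  refine ⟨n, ?_⟩
  simp only
  rw [eq_inv_of_mul_eq_one_right hn |>.symm]
  ring

lemma acloc_iteratedDeriv_lacDeriv (hM : 8 ≤ M) (h : IsCutoff χ 1) {r : ℕ} (hr : 1 ≤ r)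
    (hE : (r : ℝ) - 1 < E) : ACloc (iteratedDeriv (r - 1) (lacDeriv M E c χ 0)) := by
  intro A B hA hAB hB
  have hr1 : ((r - 1 : ℕ) : ℝ) = r - 1 := by push_cast [hr]; ring
  have hG : ∀ y, -1 < y →
      iteratedDeriv (r - 1) (lacDeriv M E c χ 0) y = lacDeriv M E c χ (r - 1) y := fun y hy =>
    iteratedDeriv_lacDeriv_of_lt hM h (by omega) hE hy
  have hloc : ∀ y, -1 < y → iteratedDeriv (r - 1) (lacDeriv M E c χ 0) =ᶠ[𝓝 y]
      lacDeriv M E c χ (r - 1) := fun y hy => by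
    filter_upwards [Ioi_mem_nhds hy] with x hx using hG x hx
  have hderiv : ∀ y, -1 < y → y ∉ {y : ℝ | ∃ n : ℕ, M ^ (n + 1) * (1 + y) = 1} →
      HasDerivAt (iteratedDeriv (r - 1) (lacDeriv M E c χ 0)) (lacDeriv M E c χ r y) y := by
    intro y hy hne
    have := hasDerivAt_lacDeriv (c := c) (E := E) (j := r - 1) hM h hy
      (Or.inl fun n hn => hne ⟨n, hn⟩)
    rw [Nat.sub_add_cancel hr] at this
    exact this.congr_of_eventuallyEq (hloc y hy)
  have hcount := countable_setOf_pow_mul_eq_one M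
  have hint : ∀ x, IntegrableOn (deriv (iteratedDeriv (r - 1) (lacDeriv M E c χ 0)))
      (Icc A x) := by
    intro x
    refine (integrableOn_lacDeriv (c := c) (E := E) (j := r) (B := x) hM h hA
      (by linarith)).congr_fun_ae ?_
    filter_upwards [ae_restrict_mem measurableSet_Icc,
      ae_restrict_of_ae (hcount.ae_notMem volume)] with y hy hne
    exact (hderiv y (by linarith [hy.1]) hne).deriv.symm
  refine ⟨hint B, fun x hx => ?_⟩
  have hftc := integral_eq_of_hasDerivAt_off_countable_of_le
    (iteratedDeriv (r - 1) (lacDeriv M E c χ 0))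
    (deriv (iteratedDeriv (r - 1) (lacDeriv M E c χ 0))) hx.1 hcount
    (fun y hy => ?_) (fun y hy => ?_)
    ((intervalIntegrable_iff_integrableOn_Icc_of_le hx.1).mpr (hint x))
  · rw [hftc]
    ring
  · have hy' : -1 < y := by linarith [hy.1]
    exact ((continuousAt_lacDeriv hM h hy' (by rw [hr1]; linarith)).congr
      (hloc y hy').symm).continuousWithinAt
  · exact (hderiv y (by linarith [hy.1.1]) hy.2).differentiableAt.hasDerivAt

end Derivatives

lemma exists_pos_coeff_tsum_lt_top {A : ℕ → ℝ≥0∞} (hA : ∀ n, A n < ⊤) {P : ℝ} (hP : 0 < P) :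
    ∃ c : ℕ → ℝ, (∀ n, 0 < c n) ∧ ∑' n, ‖c n‖ₑ ^ P * A n < ⊤ := by
  have hpos : ∀ n, 0 < (2⁻¹ : ℝ) ^ n / ((A n).toReal + 1) := fun n =>
    div_pos (by positivity) (by positivity)
  refine ⟨fun n => ((2⁻¹ : ℝ) ^ n / ((A n).toReal + 1)) ^ (1 / P),
    fun n => Real.rpow_pos_of_pos (hpos n) _, ?_⟩
  have hle : ∀ n, ‖((2⁻¹ : ℝ) ^ n / ((A n).toReal + 1)) ^ (1 / P)‖ₑ ^ P * A n
      ≤ (2⁻¹ : ℝ≥0∞) ^ n := by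
    intro n
    have hc := hpos n
    obtain ⟨x, hx⟩ : ∃ x : ℝ≥0, A n = x := ⟨(A n).toNNReal, (ENNReal.coe_toNNReal (hA n).ne).symm⟩
    rw [hx, ENNReal.coe_toReal] at hc ⊢
    rw [Real.enorm_eq_ofReal (by positivity), ENNReal.ofReal_rpow_of_nonneg (by positivity) hP.le,
      ← Real.rpow_mul hc.le, one_div_mul_cancel hP.ne', Real.rpow_one,
      ← ENNReal.ofReal_coe_nnreal, ← ENNReal.ofReal_mul hc.le]
    have h2 : (2⁻¹ : ℝ≥0∞) ^ n = ENNReal.ofReal ((2⁻¹ : ℝ) ^ n) := by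
      rw [ENNReal.ofReal_pow (by norm_num), ENNReal.ofReal_inv_of_pos (by norm_num)]
      norm_num
    rw [h2]
    refine ENNReal.ofReal_le_ofReal ?_
    rw [div_mul_eq_mul_div, div_le_iff₀ (by positivity)]
    gcongr
    linarith
  refine (ENNReal.tsum_le_tsum hle).trans_lt ?_
  rw [ENNReal.tsum_geometric_two]
  exact ENNReal.ofNat_lt_top

lemma enorm_truncPow_rpow (e : ℝ) (χ : ℝ → ℝ) {P : ℝ} (hP : 0 < P) (z : ℝ) :
    ‖truncPow e χ z‖ₑ ^ P = ‖truncPow (e * P) (fun x => |χ x| ^ P) z‖ₑ := by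
  rcases lt_or_ge 0 z with hz | hz
  · rw [truncPow_of_pos _ _ hz, truncPow_of_pos _ _ hz, ← Real.enorm_abs,
      Real.enorm_eq_ofReal (abs_nonneg _), Real.enorm_eq_ofReal (by positivity),
      ENNReal.ofReal_rpow_of_nonneg (abs_nonneg _) hP.le, abs_mul,
      abs_of_pos (Real.rpow_pos_of_pos hz e), Real.mul_rpow (by positivity) (abs_nonneg _),
      ← Real.rpow_mul hz.le]
  · rw [truncPow_of_nonpos _ _ hz, truncPow_of_nonpos _ _ hz]
    simp [hP]

lemma lintegral_weight_mul_truncPow_lt_top {w : ℝ → ℝ} (hw : ContinuousOn w (Ioo (-1) 1))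
    {P s κ m : ℝ} (hP : 0 < P) (hs : s * P < 1) (hm : 8 ≤ m) {χ : ℝ → ℝ} (hχ : IsCutoff χ κ)
    (d : ℝ) :
    ∫⁻ y in Icc (-1 : ℝ) 1, ‖w y * (d * truncPow (-s) χ (m * (1 + y) - 1))‖ₑ ^ P < ⊤ := by
  have hm0 : 0 < m := by linarith
  have hsub : Icc (-1 + 1 / m) (-1 + 3 / 2 / m) ⊆ Ioo (-1) 1 := fun y hy => by
    have h1 : 0 < 1 / m := by positivity
    have h2 : 3 / 2 / m < 1 := by rw [div_lt_one hm0]; linarith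
    exact ⟨by linarith [hy.1], by linarith [hy.2]⟩
  obtain ⟨W, hW⟩ := isCompact_Icc.exists_bound_of_continuousOn (hw.mono hsub)
  have hle : ∀ y, ‖w y * (d * truncPow (-s) χ (m * (1 + y) - 1))‖ₑ ^ P ≤
      ENNReal.ofReal (W * |d|) ^ P *
        ‖truncPow (-s * P) (fun x => |χ x| ^ P) (m * (1 + y) - 1)‖ₑ := by
    intro y
    rw [← enorm_truncPow_rpow _ _ hP, ← ENNReal.mul_rpow_of_nonneg _ _ hP.le, ← mul_assoc,
      enorm_mul]
    by_cases hy : y ∈ Icc (-1 + 1 / m) (-1 + 3 / 2 / m)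
    · gcongr
      rw [← Real.enorm_abs, Real.enorm_eq_ofReal (abs_nonneg _), abs_mul]
      refine ENNReal.ofReal_le_ofReal ?_
      gcongr
      exact hW y hy
    · have hz : truncPow (-s) χ (m * (1 + y) - 1) = 0 := by
        rw [mem_Icc, not_and_or, not_le, not_le] at hy
        rcases hy with hy | hy
        · refine truncPow_of_nonpos _ _ ?_
          have : 1 + y < 1 / m := by linarith
          rw [lt_div_iff₀ hm0] at this
          linarith
        · refine truncPow_eq_zero_of_cutoff hχ ?_
          have : 3 / 2 / m < 1 + y := by linarith
          rw [div_lt_iff₀ hm0] at this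
          linarith
      rw [hz]
      simp [hP]
  have hcont : Continuous fun x => |χ x| ^ P :=
    hχ.smooth.continuous.abs.rpow_const fun _ => Or.inr hP.le
  refine (lintegral_mono hle).trans_lt ?_
  have hmeas : Measurable fun y : ℝ => truncPow (-s * P) (fun x => |χ x| ^ P) (m * (1 + y) - 1) :=
    (measurable_truncPow _ hcont).comp (by fun_prop)
  rw [lintegral_const_mul _ hmeas.enorm]
  refine ENNReal.mul_lt_top (ENNReal.rpow_lt_top_of_nonneg hP.le ENNReal.ofReal_ne_top) ?_
  exact (integrableOn_truncPow_comp (by linarith) hcont hm0 (by norm_num)).2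

lemma exists_coeff_Jnorm_lacDeriv_lt_top {w : ℝ → ℝ} (hw : ContinuousOn w (Ioo (-1) 1))
    (hwm : Measurable w) {p : ℝ≥0∞} (hp0 : p ≠ 0) (hp : p ≠ ∞) {M s : ℝ} (hM : 8 ≤ M)
    (hs : s * p.toReal < 1) {χ : ℝ → ℝ} (hχ : IsCutoff χ 1) (r : ℕ) :
    ∃ c : ℕ → ℝ, (∀ n, 0 < c n) ∧
      Jnorm p (fun x => w x * lacDeriv M (r - s) c χ r x) (Icc (-1) 1) < ⊤ := by
  have hP : 0 < p.toReal := ENNReal.toReal_pos hp0 hp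
  obtain ⟨κ, hκ⟩ := hχ.cutoffSeq (r - s) r
  set u : ℕ → ℝ → ℝ := fun n y => w y * ((M ^ (n + 1)) ^ r *
    truncPow (-s) (cutoffSeq (r - s) χ r) (M ^ (n + 1) * (1 + y) - 1)) with hu
  have hum : ∀ n, Measurable (u n) := fun n => hwm.mul
    (((measurable_truncPow _ hκ.smooth.continuous).comp (by fun_prop)).const_mul _)
  have hA : ∀ n, ∫⁻ y in Icc (-1 : ℝ) 1, ‖u n y‖ₑ ^ p.toReal < ⊤ := fun n => by
    refine lintegral_weight_mul_truncPow_lt_top hw hP hs ?_ hκ _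
    calc 8 ≤ M := hM
      _ ≤ M ^ (n + 1) := le_self_pow₀ (by linarith) (by omega)
  obtain ⟨c, hc, hsum⟩ := exists_pos_coeff_tsum_lt_top hA hP
  refine ⟨c, hc, ?_⟩
  rw [Jnorm, eLpNorm_lt_top_iff_lintegral_rpow_enorm_lt_top hp0 hp]
  calc ∫⁻ y in Icc (-1 : ℝ) 1, ‖w y * lacDeriv M (r - s) c χ r y‖ₑ ^ p.toReal
      ≤ ∫⁻ y in Icc (-1 : ℝ) 1, ∑' n, ‖c n‖ₑ ^ p.toReal * ‖u n y‖ₑ ^ p.toReal := by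
        refine lintegral_mono_ae ?_
        filter_upwards [ae_restrict_mem measurableSet_Icc,
          ae_restrict_of_ae (Measure.ae_ne volume (-1 : ℝ))] with y hy hne
        have hy1 : -1 < y := lt_of_le_of_ne hy.1 (Ne.symm hne)
        obtain ⟨N, hN⟩ := exists_isolates hM (by linarith : 0 < 1 + y)
        have heq : w y * lacDeriv M (r - s) c χ r y = c N * u N y := by
          rw [hN.lacDeriv_eq hM hχ r, hu, sub_sub_cancel_left]
          ring
        rw [heq, enorm_mul, ENNReal.mul_rpow_of_nonneg _ _ hP.le]
        exact ENNReal.le_tsum (f := fun n => ‖c n‖ₑ ^ p.toReal * ‖u n y‖ₑ ^ p.toReal) N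
    _ = ∑' n, ‖c n‖ₑ ^ p.toReal * ∫⁻ y in Icc (-1 : ℝ) 1, ‖u n y‖ₑ ^ p.toReal := by
        rw [lintegral_tsum fun n =>
          (((hum n).enorm.pow_const _).const_mul _).aemeasurable]
        congr 1 with n
        rw [lintegral_const_mul _ ((hum n).enorm.pow_const _)]
    _ < ⊤ := hsum

lemma continuousOn_jw_mul_phi_pow (a b : ℝ) (r : ℕ) :
    ContinuousOn (fun x => jw a b x * phi x ^ r) (Ioo (-1) 1) := by
  unfold jw phi
  refine ((ContinuousOn.rpow_const (by fun_prop) fun x hx => ?_).mul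
    (ContinuousOn.rpow_const (by fun_prop) fun x hx => ?_)).mul (by fun_prop)
  · exact Or.inl (by linarith [hx.2])
  · exact Or.inl (by linarith [hx.1])

lemma measurable_jw_mul_phi_pow (a b : ℝ) (r : ℕ) :
    Measurable (fun x => jw a b x * phi x ^ r) := by
  unfold jw phi
  fun_prop

section BlowUp

variable {M s : ℝ} {g : ℝ → ℝ} {C : ℕ → ℝ}

/-- `g` vanishes away from the intervals `1 ≤ Mⁿ⁺¹(1+y) ≤ 3/2`, and has a one-sided singularity of
order `s` at the left end of each of them. -/
structure HasBumps (M s : ℝ) (C : ℕ → ℝ) (g : ℝ → ℝ) : Prop where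
  gap : ∀ (y : ℝ) (N : ℕ), M ^ N * (1 + y) < 1 → 3 / 2 < M ^ (N + 1) * (1 + y) → g y = 0
  bump : ∀ (y : ℝ) (n : ℕ), 1 < M ^ (n + 1) * (1 + y) → M ^ (n + 1) * (1 + y) < 5 / 4 →
    g y = C n * (M ^ (n + 1) * (1 + y) - 1) ^ (-s)

lemma phi_mul_bounds {u δ : ℝ} (hu : 0 < u) (hu1 : u ≤ 1 / 2) (hδ : 0 < δ) (hδ1 : δ ≤ 1) :
    u / √(u * (2 - u)) * phi (-1 + u + δ) ∈ Icc u (u + δ / 2) := by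
  have hpos : 0 < u * (2 - u) := mul_pos hu (by linarith)
  have hs : 0 < √(u * (2 - u)) := Real.sqrt_pos.mpr hpos
  rw [div_mul_eq_mul_div, mem_Icc, le_div_iff₀ hs, div_le_iff₀ hs, phi]
  constructor
  · gcongr
    nlinarith
  · have h : √(1 - (-1 + u + δ) ^ 2) ≤ (1 + δ / (2 * u)) * √(u * (2 - u)) := by
      refine Real.sqrt_le_iff.mpr ⟨by positivity, ?_⟩
      rw [mul_pow, Real.sq_sqrt hpos.le]
      have h1 : (1 + δ / (2 * u)) ^ 2 * (u * (2 - u)) =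
          u * (2 - u) + δ * (2 - u) + δ ^ 2 * (2 - u) / (4 * u) := by
        field_simp
        ring
      have h2 : 0 ≤ δ ^ 2 * (2 - u) / (4 * u) :=
        div_nonneg (mul_nonneg (sq_nonneg _) (by linarith)) (by linarith)
      rw [h1]
      nlinarith
    calc u * √(1 - (-1 + u + δ) ^ 2) ≤ u * ((1 + δ / (2 * u)) * √(u * (2 - u))) := by gcongr
      _ = (u + δ / 2) * √(u * (2 - u)) := by field_simp

lemma HasBumps.sdiff_eq {k : ℕ} (hk : 1 ≤ k) (hg : HasBumps (8 * k) s C g) {u δ ε τ H : ℝ}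
    {n m : ℕ} (hu : (8 * (k : ℝ)) ^ (n + 1) * (2 * u) = 1)
    (hε : (8 * (k : ℝ)) ^ (m + 1) * ε = 1) (hδε : δ ∈ Icc (4 * ε) (5 * ε)) (hδ : 4 * k * δ < u)
    (hτ : τ ∈ Icc u (u + δ / 2)) (hH : k * H / 2 = τ) :
    sdiff k H g (-1 + u + δ) = C n * ((8 * (k : ℝ)) ^ (n + 1) * (u + δ + τ) - 1) ^ (-s) := by
  have hk1 : (1 : ℝ) ≤ k := by exact_mod_cast hk
  set M : ℝ := 8 * k with hMdef
  have hM : 8 ≤ M := by linarith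
  have hMn : 0 < M ^ (n + 1) := by positivity
  have hMm : 0 < M ^ m := by positivity
  have hu0 : 0 < u := by nlinarith
  have hε0 : 0 < ε := pos_of_mul_pos_right (by rw [hε]; exact one_pos) (by positivity)
  obtain ⟨hτ1, hτ2⟩ := hτ
  have hτ0 : 0 < τ := by linarith
  obtain ⟨hδ1, hδ2⟩ := hδε
  have hδu : 4 * δ < u := by nlinarith
  have hu1 : u ≤ 1 / 16 := by
    have : 8 ≤ M ^ (n + 1) := hM.trans (le_self_pow₀ (by linarith) (by omega))
    nlinarith
  have hsub : Icc (-1 + u + δ - k * H / 2) (-1 + u + δ + k * H / 2) ⊆ Icc (-1) 1 := by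
    rw [hH]
    exact Icc_subset_Icc (by linarith) (by linarith)
  rw [_root_.sdiff, sdiffOn, if_pos hsub, Finset.sum_range_succ, Finset.sum_eq_zero, zero_add]
  · have hy : -1 + u + δ - k * H / 2 + k * H = -1 + (u + δ + τ) := by linarith
    have hv : 1 + (-1 + (u + δ + τ)) = u + δ + τ := by ring
    rw [hy, hg.bump _ n, hv]
    · simp
    · rw [hv]
      nlinarith
    · rw [hv]
      nlinarith
  · intro i hi
    rw [Finset.mem_range] at hi
    have hgi : g (-1 + u + δ - k * H / 2 + i * H) = 0 := by
      have hiH : (i : ℝ) * H = i * (2 * τ / k) := by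
        rw [← hH]
        field_simp
      rcases Nat.eq_zero_or_pos i with h0 | h0
      · subst h0
        refine hg.gap _ m ?_ ?_
        · have h1 : 1 + (-1 + u + δ - k * H / 2 + ((0 : ℕ) : ℝ) * H) ≤ 5 * ε := by
            rw [hH]
            push_cast
            linarith
          have h2 : M ^ m * ε * 8 ≤ 1 := by
            rw [← hε, pow_succ]
            nlinarith [mul_pos hMm hε0]
          nlinarith [mul_pos hMm hε0]
        · have h1 : 2 * ε ≤ 1 + (-1 + u + δ - k * H / 2 + ((0 : ℕ) : ℝ) * H) := by
            rw [hH]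
            push_cast
            linarith
          have h2 : 0 < M ^ (m + 1) := by positivity
          nlinarith
      · have hi1 : (1 : ℝ) ≤ i := by exact_mod_cast h0
        have hik : (i : ℝ) + 1 ≤ k := by exact_mod_cast hi
        have hk0 : (0 : ℝ) < k := by linarith
        have hv : 1 + (-1 + u + δ - k * H / 2 + i * H) = u + δ - τ + i * (2 * τ / k) := by
          rw [hiH, hH]
          ring
        refine hg.gap _ (n + 1) ?_ ?_
        · have h1 : u + δ - τ + i * (2 * τ / k) < 2 * u := by
            have h2 : (i : ℝ) * (2 * τ / k) ≤ 2 * τ - 2 * τ / k := by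
              have : 2 * τ - 2 * τ / k = (k - 1) * (2 * τ / k) := by field_simp
              rw [this]
              have hq : 0 ≤ 2 * τ / k := by positivity
              nlinarith
            have h3 : 4 * δ < 2 * τ / k := by
              rw [lt_div_iff₀ hk0]
              nlinarith
            linarith
          rw [hv]
          nlinarith
        · have h1 : 2 * u / k ≤ u + δ - τ + i * (2 * τ / k) := by
            have h2 : 2 * u / k ≤ 2 * τ / k := by gcongr
            have hq : 0 ≤ 2 * τ / k := by positivity
            nlinarith
          have h2 : M ^ (n + 1 + 1) * (2 * u / k) = 8 := by
            have : M ^ (n + 1 + 1) * (2 * u / k) = M ^ (n + 1) * (2 * u) * (M / k) := by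
              rw [pow_succ]
              ring
            rw [this, hu, hMdef]
            field_simp
          have h3 : 0 < M ^ (n + 1 + 1) := by positivity
          rw [hv]
          nlinarith
    rw [hgi, mul_zero]

lemma min_one_two_rpow_le {z : ℝ} (e : ℝ) (h1 : 1 ≤ z) (h2 : z ≤ 2) : min 1 (2 ^ e) ≤ z ^ e := by
  rcases le_or_gt 0 e with he | he
  · exact (min_le_left _ _).trans (Real.one_le_rpow h1 he)
  · exact (min_le_right _ _).trans (Real.rpow_le_rpow_of_nonpos (by linarith) h2 he.le)

lemma HasBumps.le_jwt_mul_sdiff {k : ℕ} (hk : 1 ≤ k) (hg : HasBumps (8 * k) s C g)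
    (hs : 0 < s) (ξ : ℝ) {q : ℝ} (hq : q < 0) {u δ ε h : ℝ} {n m : ℕ} (hC : 0 < C n)
    (hu : (8 * (k : ℝ)) ^ (n + 1) * (2 * u) = 1)
    (hε : (8 * (k : ℝ)) ^ (m + 1) * ε = 1) (hδε : δ ∈ Icc (4 * ε) (5 * ε)) (hδ : 4 * k * δ < u)
    (hh : k * h / 2 = u / √(u * (2 - u))) :
    min 1 (2 ^ ξ) * (C n * (1 / u) ^ (-s)) * δ ^ (q - s) ≤
      jwt (k * h) ξ q (-1 + u + δ) * sdiff k (h * phi (-1 + u + δ)) g (-1 + u + δ) := by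
  have hk1 : (1 : ℝ) ≤ k := by exact_mod_cast hk
  have hM : 8 ≤ 8 * (k : ℝ) := by linarith
  have hu0 : 0 < u := by
    have : 0 < 2 * u := pos_of_mul_pos_right (by rw [hu]; exact one_pos) (by positivity)
    linarith
  have hu1 : u ≤ 1 / 16 := by
    have : 8 ≤ (8 * (k : ℝ)) ^ (n + 1) := hM.trans (le_self_pow₀ (by linarith) (by omega))
    nlinarith
  have hε0 : 0 < ε := pos_of_mul_pos_right (by rw [hε]; exact one_pos) (by positivity)
  have hδ0 : 0 < δ := by linarith [hδε.1]
  have hδu : 4 * δ < u := by nlinarith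
  have hτ := phi_mul_bounds hu0 (by linarith) hδ0 (by linarith)
  rw [← hh] at hτ
  set τ := k * h / 2 * phi (-1 + u + δ) with hτdef
  have hH : k * (h * phi (-1 + u + δ)) / 2 = τ := by rw [hτdef]; ring
  have hH' : k * h * phi (-1 + u + δ) / 2 = τ := by rw [hτdef]; ring
  rw [hg.sdiff_eq hk hu hε hδε hδ hτ hH, jwt, hH']
  obtain ⟨hτ1, hτ2⟩ := hτ
  have hMn : 0 < (8 * (k : ℝ)) ^ (n + 1) := by positivity
  have hMu : (8 * (k : ℝ)) ^ (n + 1) = 1 / (2 * u) := eq_one_div_of_mul_eq_one_left hu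
  have hz1 : 0 < (8 * (k : ℝ)) ^ (n + 1) * (u + δ + τ) - 1 := by nlinarith
  have hz2 : (8 * (k : ℝ)) ^ (n + 1) * (u + δ + τ) - 1 ≤ 1 / u * δ := by
    rw [hMu, div_mul_eq_mul_div, div_mul_eq_mul_div, sub_le_iff_le_add,
      div_add_one hu0.ne', div_le_div_iff₀ (by positivity) hu0]
    nlinarith
  have hδq : δ ^ (q - s) = δ ^ q * δ ^ (-s) := by rw [← Real.rpow_add hδ0]; congr 1
  have hw1 : min 1 (2 ^ ξ) ≤ (1 - (-1 + u + δ) - τ) ^ ξ :=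
    min_one_two_rpow_le ξ (by linarith) (by linarith)
  have hw2 : δ ^ q ≤ (1 + (-1 + u + δ) - τ) ^ q :=
    Real.rpow_le_rpow_of_nonpos (by linarith) (by linarith) hq.le
  have hsing : (1 / u * δ) ^ (-s) ≤ ((8 * (k : ℝ)) ^ (n + 1) * (u + δ + τ) - 1) ^ (-s) :=
    Real.rpow_le_rpow_of_nonpos hz1 hz2 (by linarith)
  calc min 1 (2 ^ ξ) * (C n * (1 / u) ^ (-s)) * δ ^ (q - s)
      = min 1 (2 ^ ξ) * δ ^ q * (C n * (1 / u * δ) ^ (-s)) := by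
        rw [hδq, Real.mul_rpow (by positivity) hδ0.le]
        ring
    _ ≤ _ := by
        have h0 : (0 : ℝ) ≤ min 1 (2 ^ ξ) := by positivity
        have h1 : 0 ≤ (1 - (-1 + u + δ) - τ) ^ ξ := h0.trans hw1
        have h2 : 0 ≤ (1 + (-1 + u + δ) - τ) ^ q :=
          (Real.rpow_nonneg hδ0.le q).trans hw2
        have h3 := mul_nonneg h1 h2
        gcongr

lemma HasBumps.Jnorm_eq_top {k : ℕ} (hk : 1 ≤ k) (hg : HasBumps (8 * k) s C g) (hs : 0 < s)
    (ξ : ℝ) {q : ℝ} (hq : q < 0) {p : ℝ≥0∞} (hp0 : p ≠ 0) (hp : p ≠ ∞)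
    (hqs : 1 ≤ (s - q) * p.toReal) {u h : ℝ} {n : ℕ} (hC : 0 < C n)
    (hu : (8 * (k : ℝ)) ^ (n + 1) * (2 * u) = 1) (hh : k * h / 2 = u / √(u * (2 - u))) :
    Jnorm p (fun x => jwt (k * h) ξ q x * sdiff k (h * phi x) g x) (Icc (-1) 1) = ⊤ := by
  have hk1 : (1 : ℝ) ≤ k := by exact_mod_cast hk
  have hP : 0 < p.toReal := ENNReal.toReal_pos hp0 hp
  have hu0 : 0 < u := by
    have : 0 < 2 * u := pos_of_mul_pos_right (by rw [hu]; exact one_pos) (by positivity)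
    linarith
  have hM : 8 ≤ 8 * (k : ℝ) := by linarith
  have hu1 : u ≤ 1 / 16 := by
    have : 8 ≤ (8 * (k : ℝ)) ^ (n + 1) := hM.trans (le_self_pow₀ (by linarith) (by omega))
    nlinarith
  set K := min 1 (2 ^ ξ) * (C n * (1 / u) ^ (-s)) with hKdef
  have hK : 0 < K := by positivity
  by_contra hne
  have hfin := (eLpNorm_lt_top_iff_lintegral_rpow_enorm_lt_top hp0 hp).mp
    (lt_top_iff_ne_top.mpr hne)
  set ε : ℕ → ℝ := fun m => ((8 * (k : ℝ)) ^ (m + 1))⁻¹ with hεdef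
  have hεlim : Tendsto ε atTop (𝓝 0) :=
    ((tendsto_pow_atTop_atTop_of_one_lt (by linarith)).comp
      (tendsto_add_atTop_nat 1)).inv_tendsto_atTop
  set S : ℕ → Set ℝ := fun m => Icc (-1 + u + 4 * ε m) (-1 + u + 5 * ε m) with hSdef
  have hvol : ∀ m, volume (S m) = ENNReal.ofReal (ε m) := fun m => by
    rw [hSdef, Real.volume_Icc]
    congr 1
    ring
  have hSlim : Tendsto ((volume.restrict (Icc (-1 : ℝ) 1)) ∘ S) atTop (𝓝 0) := by
    refine tendsto_of_tendsto_of_tendsto_of_le_of_le tendsto_const_nhds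
      (h := fun m => ENNReal.ofReal (ε m)) ?_ (fun _ => bot_le) fun m => ?_
    · simpa using ENNReal.tendsto_ofReal hεlim
    · simp only [← hvol]
      exact Measure.restrict_apply_le _ _
  have hlim := tendsto_setLIntegral_zero hfin.ne hSlim
  have hlow : ∀ᶠ m in atTop, ENNReal.ofReal (K ^ p.toReal / 5) ≤
      ∫⁻ x in S m, ‖jwt (k * h) ξ q x * sdiff k (h * phi x) g x‖ₑ ^ p.toReal
        ∂volume.restrict (Icc (-1) 1) := by
    filter_upwards [hεlim.eventually (gt_mem_nhds (by positivity : 0 < u / (20 * k)))] with m hm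
    have hε0 : 0 < ε m := by positivity
    have hε1 : (8 * (k : ℝ)) ^ (m + 1) * ε m = 1 := mul_inv_cancel₀ (by positivity)
    rw [lt_div_iff₀ (by positivity)] at hm
    have hm5 : 20 * ε m < u := by nlinarith
    have hsub : S m ⊆ Icc (-1) 1 := Icc_subset_Icc (by linarith) (by linarith)
    rw [Measure.restrict_restrict_of_subset hsub]
    calc ENNReal.ofReal (K ^ p.toReal / 5)
        = ENNReal.ofReal (K ^ p.toReal / (5 * ε m)) * volume (S m) := by
          rw [hvol, ← ENNReal.ofReal_mul (by positivity)]
          congr 1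
          field_simp
      _ ≤ _ := by
          rw [← setLIntegral_const]
          refine setLIntegral_mono' measurableSet_Icc fun x hx => ?_
          have hδε : x + 1 - u ∈ Icc (4 * ε m) (5 * ε m) :=
            ⟨by linarith [hx.1], by linarith [hx.2]⟩
          have hδ0 : 0 < x + 1 - u := by linarith [hδε.1]
          have hle := hg.le_jwt_mul_sdiff hk hs ξ hq hC hu hε1 hδε
            (by nlinarith [hδε.2]) hh
          rw [show -1 + u + (x + 1 - u) = x by ring, ← hKdef] at hle
          have hKδ : 0 ≤ K * (x + 1 - u) ^ (q - s) := by positivity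
          rw [Real.enorm_eq_ofReal (hKδ.trans hle),
            ENNReal.ofReal_rpow_of_nonneg (hKδ.trans hle) hP.le]
          refine ENNReal.ofReal_le_ofReal ?_
          calc K ^ p.toReal / (5 * ε m) ≤ K ^ p.toReal / (x + 1 - u) := by
                gcongr
                exact hδε.2
            _ = K ^ p.toReal * (x + 1 - u) ^ (-1 : ℝ) := by
                rw [Real.rpow_neg_one, div_eq_mul_inv]
            _ ≤ K ^ p.toReal * (x + 1 - u) ^ ((q - s) * p.toReal) := by
                gcongr ?_ * ?_
                exact Real.rpow_le_rpow_of_exponent_ge hδ0 (by linarith [hδε.2]) (by linarith)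
            _ = (K * (x + 1 - u) ^ (q - s)) ^ p.toReal := by
                rw [Real.mul_rpow hK.le (by positivity), ← Real.rpow_mul hδ0.le]
            _ ≤ _ := by gcongr
  have hcontra := ge_of_tendsto hlim hlow
  rw [nonpos_iff_eq_zero, ENNReal.ofReal_eq_zero] at hcontra
  have : 0 < K ^ p.toReal / 5 := by positivity
  linarith

lemma HasBumps.wmod_eq_top {k r : ℕ} (hk : 1 ≤ k) (hg : HasBumps (8 * k) s C g) (hs : 0 < s)
    (hC : ∀ n, 0 < C n) {p : ℝ≥0∞} (hp0 : p ≠ 0) (hp : p ≠ ∞) (a : ℝ) {b : ℝ}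
    (hb : (r : ℝ) / 2 + b < 0) (hqs : 1 ≤ (s - ((r : ℝ) / 2 + b)) * p.toReal) {t : ℝ}
    (ht : 0 < t) : wmod k r a b p g t = ⊤ := by
  have hk1 : (1 : ℝ) ≤ k := by exact_mod_cast hk
  obtain ⟨n, hn⟩ := pow_unbounded_of_one_lt (2 / t ^ 2) (by linarith : 1 < 8 * (k : ℝ))
  have hMn : 8 ≤ (8 * (k : ℝ)) ^ (n + 1) :=
    (by linarith : 8 ≤ 8 * (k : ℝ)).trans (le_self_pow₀ (by linarith) (by omega))
  set u : ℝ := 1 / (2 * (8 * (k : ℝ)) ^ (n + 1)) with hudef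
  have hu0 : 0 < u := by positivity
  have hu : (8 * (k : ℝ)) ^ (n + 1) * (2 * u) = 1 := by rw [hudef]; field_simp
  have hu1 : u ≤ 1 := by nlinarith
  have hut : u ≤ (t / 2) ^ 2 := by
    rw [div_lt_iff₀ (by positivity)] at hn
    have h1 : (8 * (k : ℝ)) ^ n ≤ (8 * (k : ℝ)) ^ (n + 1) :=
      pow_le_pow_right₀ (by linarith) (by omega)
    rw [hudef, div_le_iff₀ (by positivity)]
    nlinarith [sq_nonneg t]
  have hpos : 0 < u * (2 - u) := mul_pos hu0 (by linarith)
  have hκ : u / √(u * (2 - u)) ≤ t / 2 := by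
    rw [div_le_iff₀ (Real.sqrt_pos.mpr hpos)]
    calc u ≤ √(u * (u * (2 - u))) := Real.le_sqrt_of_sq_le (by nlinarith)
      _ = √u * √(u * (2 - u)) := Real.sqrt_mul hu0.le _
      _ ≤ t / 2 * √(u * (2 - u)) := by
        gcongr
        exact Real.sqrt_le_iff.mpr ⟨by linarith, hut⟩
  have hκ0 : 0 < u / √(u * (2 - u)) := div_pos hu0 (Real.sqrt_pos.mpr hpos)
  set κ := u / √(u * (2 - u)) with hκdef
  have hht : 2 * κ / k ∈ Ioc 0 t := by
    refine ⟨by positivity, ?_⟩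
    rw [div_le_iff₀ (by linarith)]
    nlinarith
  refine top_le_iff.mp ?_
  rw [← hg.Jnorm_eq_top hk hs ((r : ℝ) / 2 + a) hb hp0 hp hqs (hC n) hu
    (h := 2 * κ / k) (by rw [hκdef]; field_simp)]
  exact le_iSup₂ (f := fun h (_ : h ∈ Ioc (0 : ℝ) t) => Jnorm p
      (fun x => jwt (k * h) ((r : ℝ) / 2 + a) ((r : ℝ) / 2 + b) x *
        _root_.sdiff k (h * phi x) g x) (Icc (-1) 1)) (2 * κ / k) hht

end BlowUp

lemma hasBumps_iteratedDeriv_lacDeriv {M E s κ : ℝ} {c : ℕ → ℝ} {χ : ℝ → ℝ} {r : ℕ} (hM : 8 ≤ M)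
    (hχ : IsCutoff χ 1) (hκ : IsCutoff (cutoffSeq E χ r) κ) (hE : 1 ≤ r → (r : ℝ) - 1 < E)
    (hs : E - r = -s) :
    HasBumps M s (fun n => c n * (M ^ (n + 1)) ^ r * κ)
      (iteratedDeriv r (lacDeriv M E c χ 0)) where
  gap y N h1 h2 := by
    have hy : 0 < 1 + y := pos_of_mul_pos_right (lt_trans (by norm_num) h2) (by positivity)
    rw [iteratedDeriv_lacDeriv hM hχ hE (by linarith) fun n => ne_one_of_gap hM h1 h2 (n + 1)]
    exact lacSum_eq_zero_of_gap hM h1 h2 _ (fun z hz => truncPow_of_nonpos _ _ hz)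
      fun z hz => truncPow_eq_zero_of_cutoff hκ hz
  bump y n h1 h2 := by
    have hy : 0 < 1 + y := pos_of_mul_pos_right (one_pos.trans h1) (by positivity)
    have hlow : M ^ n * (1 + y) < 1 := by
      have : 0 < M ^ n * (1 + y) := by positivity
      rw [pow_succ'] at h2
      nlinarith
    have hhigh : 3 / 2 < M ^ (n + 2) * (1 + y) := by
      rw [pow_succ', mul_assoc]
      nlinarith
    have hne : ∀ j : ℕ, M ^ (j + 1) * (1 + y) ≠ 1 := by
      intro j
      rcases lt_or_ge j n with hj | hj
      · have : M ^ (j + 1) * (1 + y) ≤ M ^ n * (1 + y) :=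
          mul_le_mul_of_nonneg_right (pow_le_pow_right₀ (by linarith) (by omega)) hy.le
        linarith
      · have : M ^ (n + 1) * (1 + y) ≤ M ^ (j + 1) * (1 + y) :=
          mul_le_mul_of_nonneg_right (pow_le_pow_right₀ (by linarith) (by omega)) hy.le
        linarith
    have hiso : Isolates M n (1 + y) := ⟨Or.inr hlow, hhigh⟩
    rw [iteratedDeriv_lacDeriv hM hχ hE (by linarith) hne, hiso.lacDeriv_eq hM hχ,
      truncPow_of_pos _ _ (by linarith), hκ.left _ (by linarith), hs]
    ring

lemma exists_singularity_exponent {P q : ℝ} (hP : 0 < P) (hq : q < 0) {r : ℕ}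
    (hqr : 1 ≤ r → q < 1 - 1 / P) :
    ∃ s, 0 < s ∧ s * P < 1 ∧ 1 ≤ (s - q) * P ∧ (1 ≤ r → s < 1) := by
  have hP' : 0 < 1 / P := by positivity
  suffices ∃ s, 0 < s ∧ s < 1 / P ∧ 1 / P + q < s ∧ (1 ≤ r → s < 1) by
    obtain ⟨s, h0, h1, h2, h3⟩ := this
    refine ⟨s, h0, (lt_div_iff₀ hP).mp h1, ?_, h3⟩
    exact (div_le_iff₀ hP).mp (by linarith)
  rcases Nat.eq_zero_or_pos r with hr | hr
  · obtain ⟨s, h1, h2⟩ := exists_between (max_lt hP' (by linarith : 1 / P + q < 1 / P))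
    rw [max_lt_iff] at h1
    exact ⟨s, h1.1, h2, h1.2, fun h => by omega⟩
  · obtain ⟨s, h1, h2⟩ := exists_between (max_lt (lt_min hP' one_pos)
      (lt_min (by linarith) (by linarith [hqr hr]) : 1 / P + q < min (1 / P) 1))
    rw [max_lt_iff] at h1
    rw [lt_min_iff] at h2
    exact ⟨s, h1.1, h2.1, h1.2, fun _ => h2.2⟩

theorem stmt11 (k r : ℕ) (hk : 1 ≤ k) (a : ℝ) (p : ℝ≥0∞)
    (hp0 : 0 < p) (hpfin : p ≠ ∞) (b : ℝ) (hb : (r : ℝ) / 2 + b < 0)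
    (hextra : p < 1 → 1 ≤ r → (r : ℝ) / 2 + b < 1 - 1 / p.toReal) :
    ∃ f : ℝ → ℝ, MemB p r a b f ∧
      ∀ t : ℝ, 0 < t → wmod k r a b p (iteratedDeriv r f) t = ⊤ := by
  have hP : 0 < p.toReal := ENNReal.toReal_pos hp0.ne' hpfin
  obtain ⟨s, hs0, hsP, hqs, hs1⟩ := exists_singularity_exponent (r := r) hP hb fun hr => by
    rcases lt_or_ge p 1 with hp1 | hp1
    · exact hextra hp1 hr
    · have h1 : 1 ≤ p.toReal := by
        simpa using ENNReal.toReal_mono hpfin hp1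
      have h2 : 1 / p.toReal ≤ 1 := (div_le_one hP).mpr h1
      linarith
  have hM : 8 ≤ 8 * (k : ℝ) := by
    have : (1 : ℝ) ≤ k := by exact_mod_cast hk
    linarith
  have hE : 1 ≤ r → (r : ℝ) - 1 < r - s := fun hr => by linarith [hs1 hr]
  obtain ⟨χ, hχ⟩ := exists_isCutoff
  obtain ⟨κ, hκ0, hκ⟩ := hχ.exists_cutoffSeq (r - s) r fun i hi => by
    have : (i : ℝ) + 1 ≤ r := by exact_mod_cast hi
    linarith [hE (by omega)]
  obtain ⟨c, hc, hfin⟩ := exists_coeff_Jnorm_lacDeriv_lt_top (continuousOn_jw_mul_phi_pow a b r)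
    (measurable_jw_mul_phi_pow a b r) hp0.ne' hpfin hM hsP hχ r
  refine ⟨lacDeriv (8 * k) (r - s) c χ 0,
    ⟨fun hr => acloc_iteratedDeriv_lacDeriv hM hχ hr (hE hr), ?_⟩, fun t ht => ?_⟩
  · refine lt_of_eq_of_lt (eLpNorm_congr_ae ?_) hfin
    filter_upwards [ae_restrict_mem measurableSet_Icc,
      ae_restrict_of_ae (Measure.ae_ne volume (-1 : ℝ)),
      ae_restrict_of_ae ((countable_setOf_pow_mul_eq_one (8 * (k : ℝ))).ae_notMem volume)]
      with y hy hne hns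
    rw [iteratedDeriv_lacDeriv hM hχ hE (lt_of_le_of_ne hy.1 (Ne.symm hne))
      fun n hn => hns ⟨n, hn⟩]
  · refine (hasBumps_iteratedDeriv_lacDeriv hM hχ hκ hE (by ring)).wmod_eq_top hk hs0
      (fun n => ?_) hp0.ne' hpfin a hb hqs ht
    have := hc n
    positivity

end
end

section
/- Let α,β∈ℝ and δ>0. For every x∈Dom_{2δ} and every u∈[x−δφ(x)/2, x+δφ(x)/2] one has 2^{−|α|−|β|}·w_{α,β}(u) ≤ w_{α,β}(x) ≤ 2^{|α|+|β|}·w_{α,β}(u); in particular φ(u)/2 ≤ φ(x) ≤ 2φ(u). Moreover, for every x∈Dom_{2δ}: 2^{−|α|−|β|}·w_{α,β}(x) ≤ w̃_δ^{α,β}(x) ≤ 2^{|α|+|β|}·w_{α,β}(x). -/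
open MeasureTheory Set Filter Topology
open scoped ENNReal NNReal

noncomputable section

/-- Real powers of comparable positive numbers are comparable. -/
theorem rpow_le_two_rpow_abs_mul {A B : ℝ} (a : ℝ) (hA : 0 < A) (hB : 0 < B)
    (hAB : A ≤ 2 * B) (hBA : B ≤ 2 * A) : A ^ a ≤ 2 ^ |a| * B ^ a := by
  rcases le_total 0 a with ha | ha
  · rw [abs_of_nonneg ha, ← Real.mul_rpow (by norm_num) hB.le]
    exact Real.rpow_le_rpow hA.le hAB ha
  · have h : (2 * A) ^ a ≤ B ^ a := Real.rpow_le_rpow_of_nonpos hB hBA ha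
    rw [Real.mul_rpow (by norm_num) hA.le] at h
    rw [abs_of_nonpos ha, Real.rpow_neg (by norm_num), inv_mul_eq_div,
      le_div_iff₀ (Real.rpow_pos_of_pos (by norm_num) a)]
    linarith

theorem rpow_mul_rpow_le {A B C D : ℝ} (a b : ℝ) (hA : 0 < A) (hB : 0 < B) (hC : 0 < C)
    (hD : 0 < D) (hAB : A ≤ 2 * B) (hBA : B ≤ 2 * A) (hCD : C ≤ 2 * D) (hDC : D ≤ 2 * C) :
    A ^ a * C ^ b ≤ 2 ^ (|a| + |b|) * (B ^ a * D ^ b) := by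
  calc A ^ a * C ^ b ≤ (2 ^ |a| * B ^ a) * (2 ^ |b| * D ^ b) :=
        mul_le_mul (rpow_le_two_rpow_abs_mul a hA hB hAB hBA)
          (rpow_le_two_rpow_abs_mul b hC hD hCD hDC) (by positivity) (by positivity)
    _ = 2 ^ (|a| + |b|) * (B ^ a * D ^ b) := by
        rw [Real.rpow_add (by norm_num)]; ring

theorem two_rpow_neg_mul_le {c p q : ℝ} (h : p ≤ 2 ^ c * q) : (2 : ℝ) ^ (-c) * p ≤ q := by
  rw [Real.rpow_neg (by norm_num), inv_mul_le_iff₀ (Real.rpow_pos_of_pos (by norm_num) c)]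
  exact h

theorem abs_lt_one_of_mem_Dom {d x : ℝ} (hd : 0 < d) (hx : x ∈ Dom d) : |x| < 1 := by
  have : 0 < 2 * d ^ 2 / (4 + d ^ 2) := by positivity
  rw [abs_lt]
  constructor <;> linarith [hx.1, hx.2]

/-- On `Dom δ` one has `δ φ(x) / 2 ≤ 1 - |x|`. -/
theorem mul_phi_le_of_mem_Dom {d x : ℝ} (hd : 0 < d) (hx : x ∈ Dom d) :
    d * phi x / 2 ≤ 1 - |x| := by
  have h1 := abs_lt_one_of_mem_Dom hd hx
  have h2 : |x| ≤ 1 - 2 * d ^ 2 / (4 + d ^ 2) :=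
    abs_le.2 ⟨by linarith [hx.1], hx.2⟩
  have h3 : d ^ 2 * (1 + |x|) ≤ 4 * (1 - |x|) := by
    have h4 : 2 * d ^ 2 / (4 + d ^ 2) ≤ 1 - |x| := by linarith
    rw [div_le_iff₀ (by positivity)] at h4
    linarith
  have hs : phi x ^ 2 = 1 - |x| ^ 2 := by
    rw [phi, Real.sq_sqrt, sq_abs]
    rw [← sq_abs]
    nlinarith [abs_nonneg x]
  refine (abs_le_of_sq_le_sq' ?_ (by linarith)).2
  rw [div_pow, mul_pow, hs]
  nlinarith [mul_le_mul_of_nonneg_right h3 (by linarith : 0 ≤ 1 - |x|)]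

theorem phi_le_two_mul_phi {x u : ℝ} (h : 1 - x ^ 2 ≤ 4 * (1 - u ^ 2)) :
    phi x ≤ 2 * phi u := by
  refine Real.sqrt_le_iff.2 ⟨mul_nonneg (by norm_num) (Real.sqrt_nonneg _), ?_⟩
  rcases le_total 0 (1 - u ^ 2) with hu | hu
  · rw [mul_pow, phi, Real.sq_sqrt hu]
    linarith
  · nlinarith [sq_nonneg (2 * phi u)]

theorem stmt12 (a b d : ℝ) (hd : 0 < d) (x : ℝ) (hx : x ∈ Dom (2 * d)) :
    (∀ u ∈ Icc (x - d * phi x / 2) (x + d * phi x / 2),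
      (2 : ℝ) ^ (-(|a| + |b|)) * jw a b u ≤ jw a b x ∧
      jw a b x ≤ (2 : ℝ) ^ (|a| + |b|) * jw a b u ∧
      phi u / 2 ≤ phi x ∧ phi x ≤ 2 * phi u) ∧
    (2 : ℝ) ^ (-(|a| + |b|)) * jw a b x ≤ jwt d a b x ∧
    jwt d a b x ≤ (2 : ℝ) ^ (|a| + |b|) * jw a b x := by
  have hd2 : 0 < 2 * d := by linarith
  have hx1 := abs_lt.1 (abs_lt_one_of_mem_Dom hd2 hx)
  have hs := mul_phi_le_of_mem_Dom hd2 hx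
  have hs1 : d * phi x ≤ 1 - x := by linarith [le_abs_self x]
  have hs2 : d * phi x ≤ 1 + x := by linarith [neg_abs_le x]
  have hs0 : 0 ≤ d * phi x := mul_nonneg hd.le (Real.sqrt_nonneg _)
  refine ⟨fun u hu => ?_, ?_, ?_⟩
  · obtain ⟨hu1, hu2⟩ := hu
    refine ⟨two_rpow_neg_mul_le ?_, ?_, ?_, ?_⟩
    · apply rpow_mul_rpow_le <;> linarith
    · apply rpow_mul_rpow_le <;> linarith
    · have : phi u ≤ 2 * phi x := by
        apply phi_le_two_mul_phi
        have := mul_le_mul (by linarith : 1 - u ≤ 2 * (1 - x))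
          (by linarith : 1 + u ≤ 2 * (1 + x)) (by linarith) (by linarith)
        linarith
      linarith
    · apply phi_le_two_mul_phi
      have := mul_le_mul (by linarith : 1 - x ≤ 2 * (1 - u))
        (by linarith : 1 + x ≤ 2 * (1 + u)) (by linarith) (by linarith)
      linarith
  · apply two_rpow_neg_mul_le
    apply rpow_mul_rpow_le <;> linarith
  · apply rpow_mul_rpow_le <;> linarith

end
end

section
/- Let k∈ℕ, r∈ℕ₀, let α,β∈ℝ satisfy r/2+α≥0 and r/2+β≥0, and let f∈B_∞^r(w_{α,β})∩C^r(-1,1). Then lim_{t→0⁺} ω_{k,r}^φ(f^{(r)},t)_{α,β,∞} = 0 if and only if the following holds in the respective case: (Case 1) if r/2+α>0 and r/2+β>0: lim_{x→±1} w_{α,β}(x)φ^r(x)f^{(r)}(x)=0; (Case 2) if r/2+α>0 and r/2+β=0: lim_{x→1⁻} w_{α,β}(x)φ^r(x)f^{(r)}(x)=0 and f^{(r)} extends continuously to [-1,1); (Case 3) if r/2+α=0 and r/2+β>0: lim_{x→-1⁺} w_{α,β}(x)φ^r(x)f^{(r)}(x)=0 and f^{(r)} extends continuously to (-1,1]; (Case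 4) if r/2+α=0 and r/2+β=0: f^{(r)} extends continuously to [-1,1]. -/
open MeasureTheory Set Filter Topology
open scoped ENNReal NNReal

noncomputable section

/-- The alternating binomial sum of `g` at the nodes `x - k s / 2 + i s`. -/
def nodeSum (k : ℕ) (s : ℝ) (g : ℝ → ℝ) (x : ℝ) : ℝ :=
  ∑ i ∈ Finset.range (k + 1),
    (k.choose i : ℝ) * (-1 : ℝ) ^ (k - i) * g (x - k * s / 2 + i * s)

/-- Weighted `k`-th differences with step `h φ(x)` are uniformly small as `h → 0`, taken at all
points whose nodes lie in the open interval `(-1, 1)`. -/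
def SmallDiff (k : ℕ) (ξ ζ : ℝ) (g : ℝ → ℝ) : Prop :=
  ∀ ε > 0, ∃ t > 0, ∀ h ∈ Ioc (0 : ℝ) t, ∀ x : ℝ,
    -1 < x - k * (h * phi x) / 2 → x + k * (h * phi x) / 2 < 1 →
      |jwt (k * h) ξ ζ x * nodeSum k (h * phi x) g x| ≤ ε

lemma phi_neg (x : ℝ) : phi (-x) = phi x := by simp [phi]

lemma continuous_phi : Continuous phi := by unfold phi; fun_prop

lemma phi_nonneg (x : ℝ) : 0 ≤ phi x := Real.sqrt_nonneg _

lemma phi_le_one (x : ℝ) : phi x ≤ 1 :=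
  Real.sqrt_le_one.mpr (by nlinarith [sq_nonneg x])

lemma continuous_jw {ξ ζ : ℝ} (hξ : 0 ≤ ξ) (hζ : 0 ≤ ζ) : Continuous (jw ξ ζ) :=
  ((continuous_const.sub continuous_id).rpow_const fun _ => Or.inr hξ).mul
    ((continuous_const.add continuous_id).rpow_const fun _ => Or.inr hζ)

lemma continuous_jwt (d : ℝ) {ξ ζ : ℝ} (hξ : 0 ≤ ξ) (hζ : 0 ≤ ζ) : Continuous (jwt d ξ ζ) := by
  have := continuous_phi
  exact (Continuous.rpow_const (by fun_prop) fun _ => Or.inr hξ).mul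
    (Continuous.rpow_const (by fun_prop) fun _ => Or.inr hζ)

lemma jw_mul_phi_pow (r : ℕ) (a b : ℝ) {x : ℝ} (hx : x ∈ Ioo (-1 : ℝ) 1) :
    jw a b x * phi x ^ r = jw ((r : ℝ) / 2 + a) ((r : ℝ) / 2 + b) x := by
  have h1 : 0 < 1 - x := by linarith [hx.2]
  have h2 : 0 < 1 + x := by linarith [hx.1]
  have hp : phi x ^ r = (1 - x) ^ ((r : ℝ) / 2) * (1 + x) ^ ((r : ℝ) / 2) := by
    rw [← Real.mul_rpow h1.le h2.le, phi, Real.sqrt_eq_rpow, ← Real.rpow_natCast,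
      ← Real.rpow_mul (by nlinarith)]
    congr 1 <;> ring
  rw [hp, jw, jw, Real.rpow_add h1, Real.rpow_add h2]
  ring

lemma jwt_nonneg {d ξ ζ x : ℝ} (h1 : -1 ≤ x - d * phi x / 2) (h2 : x + d * phi x / 2 ≤ 1) :
    0 ≤ jwt d ξ ζ x :=
  mul_nonneg (Real.rpow_nonneg (by linarith) _) (Real.rpow_nonneg (by linarith) _)

lemma jwt_le_jw {d ξ ζ x y : ℝ} (hξ : 0 ≤ ξ) (hζ : 0 ≤ ζ)
    (h1 : -1 ≤ x - d * phi x / 2) (h2 : x + d * phi x / 2 ≤ 1)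
    (hy : y ∈ Icc (x - d * phi x / 2) (x + d * phi x / 2)) : jwt d ξ ζ x ≤ jw ξ ζ y := by
  obtain ⟨hy1, hy2⟩ := hy
  exact mul_le_mul (Real.rpow_le_rpow (by linarith) (by linarith) hξ)
    (Real.rpow_le_rpow (by linarith) (by linarith) hζ)
    (Real.rpow_nonneg (by linarith) _) (Real.rpow_nonneg (by linarith) _)

lemma jw_le {ξ ζ y : ℝ} (hξ : 0 ≤ ξ) (hζ : 0 ≤ ζ) (hy : y ∈ Icc (-1 : ℝ) 1) :
    jw ξ ζ y ≤ 2 ^ ξ * 2 ^ ζ := by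
  obtain ⟨hy1, hy2⟩ := hy
  exact mul_le_mul (Real.rpow_le_rpow (by linarith) (by linarith) hξ)
    (Real.rpow_le_rpow (by linarith) (by linarith) hζ)
    (Real.rpow_nonneg (by linarith) _) (by positivity)

lemma jw_neg (ξ ζ x : ℝ) : jw ξ ζ (-x) = jw ζ ξ x := by
  simp only [jw, sub_neg_eq_add, ← sub_eq_add_neg, mul_comm]

lemma jwt_neg (d ξ ζ x : ℝ) : jwt d ξ ζ (-x) = jwt d ζ ξ x := by
  simp only [jwt, phi_neg, sub_neg_eq_add, ← sub_eq_add_neg, mul_comm]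

lemma node_mem {k i : ℕ} (hi : i ∈ Finset.range (k + 1)) {s : ℝ} (hs : 0 ≤ s) (x : ℝ) :
    x - k * s / 2 + i * s ∈ Icc (x - k * s / 2) (x + k * s / 2) := by
  have hik : (i : ℝ) ≤ k := by
    exact_mod_cast Nat.lt_succ_iff.mp (Finset.mem_range.mp hi)
  have h1 : 0 ≤ (i : ℝ) * s := by positivity
  have h2 : (i : ℝ) * s ≤ k * s := by gcongr
  exact ⟨by linarith, by linarith⟩

lemma sum_choose_mul_neg_one_pow {k : ℕ} (hk : 1 ≤ k) :
    ∑ i ∈ Finset.range (k + 1), (k.choose i : ℝ) * (-1 : ℝ) ^ (k - i) = 0 := by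
  have h := add_pow (1 : ℝ) (-1) k
  rw [add_neg_cancel, zero_pow (by lia)] at h
  rw [h]
  exact Finset.sum_congr rfl fun i _ => by simp [mul_comm]

lemma nodeSum_sub_const {k : ℕ} (hk : 1 ≤ k) (s : ℝ) (g : ℝ → ℝ) (L x : ℝ) :
    nodeSum k s (fun y => g y - L) x = nodeSum k s g x := by
  simp only [nodeSum, mul_sub, Finset.sum_sub_distrib, ← Finset.sum_mul,
    sum_choose_mul_neg_one_pow hk, zero_mul, sub_zero]

lemma nodeSum_neg (k : ℕ) (s : ℝ) (g : ℝ → ℝ) (x : ℝ) :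
    |nodeSum k s (fun y => g (-y)) (-x)| = |nodeSum k s g x| := by
  have h : nodeSum k s (fun y => g (-y)) (-x) = (-1) ^ k * nodeSum k s g x := by
    rw [nodeSum, nodeSum, ← Finset.sum_range_reflect, Finset.mul_sum]
    refine Finset.sum_congr rfl fun i hi => ?_
    have hik : i ≤ k := Nat.lt_succ_iff.mp (Finset.mem_range.mp hi)
    have e1 : k + 1 - 1 - i = k - i := by lia
    have e2 : k - (k - i) = i := by lia
    have e3 : (-1 : ℝ) ^ k * (-1) ^ (k - i) = (-1) ^ i := by
      obtain ⟨m, rfl⟩ := Nat.exists_eq_add_of_le hik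
      rw [Nat.add_sub_cancel_left, pow_add, mul_assoc, ← pow_add, ← two_mul, pow_mul]
      simp
    rw [e1, e2, Nat.choose_symm hik, ← e3, Nat.cast_sub hik]
    have e4 : -(-x - (k : ℝ) * s / 2 + ((k : ℝ) - i) * s) = x - k * s / 2 + i * s := by ring
    rw [e4]
    ring
  rw [h, abs_mul]
  simp

lemma SmallDiff.comp_neg {k : ℕ} {ξ ζ : ℝ} {g : ℝ → ℝ} (H : SmallDiff k ξ ζ g) :
    SmallDiff k ζ ξ (fun x => g (-x)) := by
  intro ε hε
  obtain ⟨t, ht, H⟩ := H ε hε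
  refine ⟨t, ht, fun h hh x h1 h2 => ?_⟩
  have := H h hh (-x) (by rw [phi_neg]; linarith) (by rw [phi_neg]; linarith)
  rw [jwt_neg, phi_neg, abs_mul] at this
  rw [abs_mul]
  have e := nodeSum_neg k (h * phi x) g (-x)
  rw [neg_neg] at e
  rwa [e]

lemma continuousOn_nodeSum {k : ℕ} {h : ℝ} (hh : 0 ≤ h) {g : ℝ → ℝ}
    (hg : ContinuousOn g (Ioo (-1) 1)) :
    ContinuousOn (fun x => nodeSum k (h * phi x) g x)
      {x | -1 < x - k * (h * phi x) / 2 ∧ x + k * (h * phi x) / 2 < 1} := by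
  unfold nodeSum
  refine continuousOn_finsetSum _ fun i hi => continuousOn_const.mul ?_
  have hc := continuous_phi
  refine hg.comp (Continuous.continuousOn (by fun_prop)) fun x hx => ?_
  have := node_mem hi (mul_nonneg hh (phi_nonneg x)) x
  exact ⟨by linarith [this.1, hx.1], by linarith [this.2, hx.2]⟩

lemma sdiff_eq_nodeSum {k : ℕ} {s x : ℝ} {g : ℝ → ℝ}
    (h : Icc (x - k * s / 2) (x + k * s / 2) ⊆ Icc (-1) 1) : sdiff k s g x = nodeSum k s g x := by
  rw [_root_.sdiff, sdiffOn, if_pos h, nodeSum]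

/-- A function which is continuous on an open set satisfies there every bound that holds
almost everywhere. -/
lemma abs_le_of_ae_of_continuousOn {F : ℝ → ℝ} {U : Set ℝ} {ε : ℝ} (hU : IsOpen U)
    (hF : ContinuousOn F U) (h : ∀ᵐ x, x ∈ U → |F x| ≤ ε) {x : ℝ} (hx : x ∈ U) : |F x| ≤ ε := by
  by_contra! hlt
  have ho : IsOpen (U ∩ (fun y => |F y|) ⁻¹' Ioi ε) := hF.abs.isOpen_inter_preimage hU isOpen_Ioi
  refine (ho.measure_pos volume ⟨x, hx, hlt⟩).ne' (measure_mono_null (fun y hy => ?_) (ae_iff.mp h))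
  simpa using hy

/-- The points where one of the extreme nodes hits an endpoint form a null set. -/
lemma ae_node_ne_endpoint (d : ℝ) :
    ∀ᵐ x : ℝ, x - d * phi x / 2 ≠ -1 ∧ x + d * phi x / 2 ≠ 1 := by
  have key : ∀ x : ℝ, (d * phi x / 2) ^ 2 = d ^ 2 / 4 * (1 - x ^ 2) ∨ ¬ (0 ≤ 1 - x ^ 2) := by
    intro x
    by_cases h : 0 ≤ 1 - x ^ 2
    · left
      rw [phi, div_pow, mul_pow, Real.sq_sqrt h]
      ring
    · exact Or.inr h
  set c := d ^ 2 / 4 with hc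
  have hc0 : 0 ≤ c := by positivity
  have hfin : ({-1, 1, (c - 1) / (c + 1), (1 - c) / (c + 1)} : Set ℝ).Finite := by simp
  have hnull : ∀ᵐ x : ℝ, x ∉ ({-1, 1, (c - 1) / (c + 1), (1 - c) / (c + 1)} : Set ℝ) :=
    measure_eq_zero_iff_ae_notMem.mp (hfin.measure_zero volume)
  filter_upwards [hnull] with x hx
  simp only [mem_insert_iff, mem_singleton_iff, not_or] at hx
  obtain ⟨hx1, hx2, hx3, hx4⟩ := hx
  rw [eq_div_iff (by positivity)] at hx3 hx4
  rcases key x with h | h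
  · constructor
    · intro e
      have e' : d * phi x / 2 = 1 + x := by linarith
      rw [e'] at h
      have : (1 + x) * (x * (c + 1) - (c - 1)) = 0 := by linear_combination h
      rcases mul_eq_zero.mp this with h' | h'
      · exact hx1 (by linarith)
      · exact hx3 (by linarith)
    · intro e
      have e' : d * phi x / 2 = 1 - x := by linarith
      rw [e'] at h
      have : (1 - x) * (x * (c + 1) - (1 - c)) = 0 := by linear_combination -h
      rcases mul_eq_zero.mp this with h' | h'
      · exact hx2 (by linarith)
      · exact hx4 (by linarith)
  · have h0 : phi x = 0 := Real.sqrt_eq_zero_of_nonpos (by linarith)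
    rw [h0]
    exact ⟨fun e => hx1 (by linarith), fun e => hx2 (by linarith)⟩

lemma tendsto_wmod_iff_smallDiff {k r : ℕ} {a b : ℝ} (ha : 0 ≤ (r : ℝ) / 2 + a)
    (hb : 0 ≤ (r : ℝ) / 2 + b) {g : ℝ → ℝ} (hg : ContinuousOn g (Ioo (-1) 1)) :
    Tendsto (fun t => wmod k r a b ∞ g t) (𝓝[>] (0 : ℝ)) (𝓝 0) ↔
      SmallDiff k ((r : ℝ) / 2 + a) ((r : ℝ) / 2 + b) g := by
  set ξ := (r : ℝ) / 2 + a with hξ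
  set ζ := (r : ℝ) / 2 + b with hζ
  rw [ENNReal.tendsto_nhds_zero]
  constructor
  · intro H ε hε
    have h1 := H (ENNReal.ofReal ε) (by simpa using hε)
    obtain ⟨t, ht, ht0⟩ := (h1.and self_mem_nhdsWithin).exists
    refine ⟨t, ht0, fun h hh x hx1 hx2 => ?_⟩
    set U : Set ℝ := {x | -1 < x - k * (h * phi x) / 2 ∧ x + k * (h * phi x) / 2 < 1} with hU
    have hcφ := continuous_phi
    have hUo : IsOpen U := by
      rw [hU, ofPred_and]
      exact (isOpen_lt continuous_const (by fun_prop)).inter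
        (isOpen_lt (by fun_prop) continuous_const)
    refine abs_le_of_ae_of_continuousOn (F := fun x => jwt (k * h) ξ ζ x * nodeSum k (h * phi x) g x)
      hUo ((continuous_jwt _ ha hb).continuousOn.mul (continuousOn_nodeSum hh.1.le hg)) ?_
      (show x ∈ U from ⟨hx1, hx2⟩)
    have hle : Jnorm ∞ (fun x => jwt (k * h) ξ ζ x * sdiff k (h * phi x) g x) (Icc (-1) 1)
        ≤ ENNReal.ofReal ε := le_trans (le_iSup₂ (f := fun h (_ : h ∈ Ioc (0 : ℝ) t) =>
          Jnorm ∞ (fun x => jwt (k * h) ξ ζ x * sdiff k (h * phi x) g x) (Icc (-1) 1)) h hh) ht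
    rw [Jnorm, eLpNorm_exponent_top] at hle
    have hae := (ae_restrict_iff' measurableSet_Icc).mp
      (ae_le_eLpNormEssSup (f := fun x => jwt (k * h) ξ ζ x * sdiff k (h * phi x) g x)
        (μ := volume.restrict (Icc (-1 : ℝ) 1)))
    filter_upwards [hae] with y hy hyU
    have hnn : 0 ≤ (k : ℝ) * (h * phi y) / 2 :=
      div_nonneg (mul_nonneg k.cast_nonneg (mul_nonneg hh.1.le (phi_nonneg y))) (by norm_num)
    have hy' := (hy ⟨by linarith [hyU.1], by linarith [hyU.2]⟩).trans hle
    rw [sdiff_eq_nodeSum (Icc_subset_Icc hyU.1.le hyU.2.le), Real.enorm_eq_ofReal_abs] at hy'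
    exact (ENNReal.ofReal_le_ofReal_iff hε.le).mp hy'
  · intro H ε hε
    rcases eq_or_ne ε ⊤ with rfl | hεt
    · simp
    obtain ⟨t, ht, H⟩ := H ε.toReal (ENNReal.toReal_pos hε.ne' hεt)
    filter_upwards [Ioc_mem_nhdsGT ht] with t' ht'
    refine iSup₂_le fun h hh => ?_
    rw [Jnorm, eLpNorm_exponent_top]
    refine eLpNormEssSup_le_of_ae_enorm_bound (ae_restrict_of_ae ?_)
    filter_upwards [ae_node_ne_endpoint (k * h)] with x hx
    have hnn : 0 ≤ (k : ℝ) * (h * phi x) / 2 :=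
      div_nonneg (mul_nonneg k.cast_nonneg (mul_nonneg hh.1.le (phi_nonneg x))) (by norm_num)
    rw [mul_assoc] at hx
    by_cases hsub : Icc (x - k * (h * phi x) / 2) (x + k * (h * phi x) / 2) ⊆ Icc (-1) 1
    · rw [sdiff_eq_nodeSum hsub]
      obtain ⟨h1, h2⟩ := (Icc_subset_Icc_iff (by linarith)).mp hsub
      have := H h ⟨hh.1, hh.2.trans ht'.2⟩ x (lt_of_le_of_ne h1 hx.1.symm) (lt_of_le_of_ne h2 hx.2)
      rw [Real.enorm_eq_ofReal_abs]
      exact ENNReal.ofReal_le_of_le_toReal this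
    · simp [_root_.sdiff, sdiffOn, hsub]

/-- Fixing a small step, the last node `y` can be compared with a combination of the others, which
stays continuous up to `y = 1`. -/
lemma SmallDiff.exists_approx {k : ℕ} (hk : 1 ≤ k) {ξ ζ : ℝ} (hζ : 0 ≤ ζ)
    {g : ℝ → ℝ} (hg : ContinuousOn g (Ioo (-1) 1)) (H : SmallDiff k ξ ζ g) {ε : ℝ} (hε : 0 < ε) :
    ∃ P : ℝ → ℝ, ContinuousAt P 1 ∧
      ∀ᶠ y in 𝓝[Ioo (-1 : ℝ) 1] 1, (1 - y) ^ ξ * |g y - P y| ≤ ε := by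
  obtain ⟨t, ht, H⟩ := H ε hε
  have hk0 : (0 : ℝ) < k := by exact_mod_cast hk
  obtain ⟨s, hs0, hs1, hs2⟩ : ∃ s : ℝ, 0 < s ∧ k * s ≤ 1 / 2 ∧ s ≤ k * t ^ 2 / 2 := by
    refine ⟨min (1 / 2 / (k : ℝ)) (k * t ^ 2 / 2), by positivity, ?_, min_le_right _ _⟩
    calc (k : ℝ) * min (1 / 2 / (k : ℝ)) (k * t ^ 2 / 2) ≤ k * (1 / 2 / k) := by
          exact mul_le_mul_of_nonneg_left (min_le_left _ _) hk0.le
      _ = 1 / 2 := by field_simp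
  have hks : 0 < k * s := by positivity
  refine ⟨fun y => -∑ i ∈ Finset.range k,
    (k.choose i : ℝ) * (-1 : ℝ) ^ (k - i) * g (y - k * s + i * s), ?_, ?_⟩
  · refine (tendsto_finsetSum _ fun i hi => ?_).neg
    refine Tendsto.mul tendsto_const_nhds ?_
    have hik : (i : ℝ) + 1 ≤ k := by exact_mod_cast Finset.mem_range.mp hi
    have h1 : 0 ≤ (i : ℝ) * s := by positivity
    have h2 : ((i : ℝ) + 1) * s ≤ k * s := by gcongr
    have hgc : ContinuousAt g (1 - k * s + i * s) :=
      hg.continuousAt (Ioo_mem_nhds (by linarith) (by linarith))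
    exact ContinuousAt.comp (f := fun y : ℝ => y - k * s + i * s) hgc (by fun_prop)
  · have hev : Ioi (1 / 2 : ℝ) ∈ 𝓝[Ioo (-1 : ℝ) 1] 1 :=
      mem_nhdsWithin_of_mem_nhds (Ioi_mem_nhds (by norm_num))
    filter_upwards [hev, self_mem_nhdsWithin] with y hy hyI
    have hy' : 1 / 2 < y := hy
    set x := y - k * s / 2 with hx
    have hx0 : 0 ≤ x := by linarith
    have hx1 : x ≤ 1 - k * s / 2 := by linarith [hyI.2]
    have hφ : k * s / 2 ≤ phi x ^ 2 := by
      rw [phi, Real.sq_sqrt (by nlinarith)]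
      nlinarith
    have hφ0 : 0 < phi x := lt_of_le_of_ne (phi_nonneg x) fun e => by
      rw [← e] at hφ; linarith
    have hst : s ≤ t * phi x := by
      refine abs_le_of_sq_le_sq' ?_ (by positivity) |>.2
      calc s ^ 2 = s * s := sq s
        _ ≤ s * (k * t ^ 2 / 2) := by gcongr
        _ = t ^ 2 * (k * s / 2) := by ring
        _ ≤ t ^ 2 * phi x ^ 2 := by gcongr
        _ = (t * phi x) ^ 2 := by ring
    have hsφ : s / phi x * phi x = s := div_mul_cancel₀ _ hφ0.ne'
    have := H (s / phi x) ⟨by positivity, (div_le_iff₀ hφ0).mpr hst⟩ x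
      (by rw [hsφ]; linarith) (by rw [hsφ]; linarith [hyI.2])
    rw [hsφ, jwt, mul_assoc (k : ℝ), hsφ] at this
    have e1 : 1 - x - k * s / 2 = 1 - y := by rw [hx]; ring
    have e2 : nodeSum k s g x = g y - -∑ i ∈ Finset.range k,
        (k.choose i : ℝ) * (-1 : ℝ) ^ (k - i) * g (y - k * s + i * s) := by
      rw [nodeSum, Finset.sum_range_succ, sub_neg_eq_add, add_comm]
      have e3 : x - k * s / 2 = y - k * s := by rw [hx]; ring
      simp [e3]
    rw [e1, e2, abs_mul, abs_mul, abs_of_nonneg (Real.rpow_nonneg (by linarith [hyI.2]) _)] at this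
    refine le_trans ?_ this
    have h1 : 1 ≤ |(1 + x - k * s / 2) ^ ζ| :=
      (Real.one_le_rpow (by linarith) hζ).trans (le_abs_self _)
    have h0 : 0 ≤ (1 - y) ^ ξ := Real.rpow_nonneg (by linarith [hyI.2]) _
    gcongr
    exact le_mul_of_one_le_right h0 h1

lemma SmallDiff.tendsto_weighted {k : ℕ} (hk : 1 ≤ k) {ξ ζ : ℝ} (hξ : 0 < ξ) (hζ : 0 ≤ ζ)
    {g : ℝ → ℝ} (hg : ContinuousOn g (Ioo (-1) 1)) (H : SmallDiff k ξ ζ g) :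
    Tendsto (fun x => jw ξ ζ x * g x) (𝓝[Ioo (-1 : ℝ) 1] 1) (𝓝 0) := by
  have hpow : Tendsto (fun y : ℝ => (1 - y) ^ ξ) (𝓝 1) (𝓝 0) := by
    have : Continuous fun y : ℝ => (1 - y) ^ ξ :=
      (continuous_const.sub continuous_id).rpow_const fun _ => Or.inr hξ.le
    simpa [Real.zero_rpow hξ.ne'] using this.tendsto 1
  have hmain : Tendsto (fun y => (1 - y) ^ ξ * g y) (𝓝[Ioo (-1 : ℝ) 1] 1) (𝓝 0) := by
    rw [Metric.tendsto_nhds]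
    intro ε hε
    obtain ⟨P, hP, hev⟩ := H.exists_approx hk hζ hg (half_pos hε)
    have hP0 : Tendsto (fun y => (1 - y) ^ ξ * P y) (𝓝[Ioo (-1 : ℝ) 1] 1) (𝓝 0) := by
      simpa using (hpow.mul hP.tendsto).mono_left nhdsWithin_le_nhds
    filter_upwards [hev, Metric.tendsto_nhds.mp hP0 _ (half_pos hε), self_mem_nhdsWithin]
      with y hy1 hy2 hyI
    have h0 : 0 ≤ (1 - y) ^ ξ := Real.rpow_nonneg (by linarith [hyI.2]) _
    rw [Real.dist_eq, sub_zero] at hy2 ⊢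
    have e : (1 - y) ^ ξ * g y = (1 - y) ^ ξ * (g y - P y) + (1 - y) ^ ξ * P y := by ring
    calc |(1 - y) ^ ξ * g y| ≤ |(1 - y) ^ ξ * (g y - P y)| + |(1 - y) ^ ξ * P y| := by
          rw [e]; exact abs_add_le _ _
      _ < ε / 2 + ε / 2 := by
          rw [abs_mul, abs_of_nonneg h0]
          exact add_lt_add_of_le_of_lt hy1 hy2
      _ = ε := add_halves ε
  have hother : Tendsto (fun y : ℝ => (1 + y) ^ ζ) (𝓝[Ioo (-1 : ℝ) 1] 1) (𝓝 ((1 + 1) ^ ζ)) := by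
    have : Continuous fun y : ℝ => (1 + y) ^ ζ :=
      (continuous_const.add continuous_id).rpow_const fun _ => Or.inr hζ
    exact (this.tendsto 1).mono_left nhdsWithin_le_nhds
  have := hother.mul hmain
  rw [mul_zero] at this
  exact this.congr fun y => by rw [jw]; ring

lemma one_mem_closure_Ioo : (1 : ℝ) ∈ closure (Ioo (-1 : ℝ) 1) := by
  rw [closure_Ioo (by norm_num)]; simp

lemma SmallDiff.exists_tendsto {k : ℕ} (hk : 1 ≤ k) {ζ : ℝ} (hζ : 0 ≤ ζ)
    {g : ℝ → ℝ} (hg : ContinuousOn g (Ioo (-1) 1)) (H : SmallDiff k 0 ζ g) :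
    ∃ L : ℝ, Tendsto g (𝓝[Ioo (-1 : ℝ) 1] 1) (𝓝 L) := by
  have : (𝓝[Ioo (-1 : ℝ) 1] (1 : ℝ)).NeBot := mem_closure_iff_nhdsWithin_neBot.mp one_mem_closure_Ioo
  refine cauchy_map_iff_exists_tendsto.mp (Metric.cauchy_iff.mpr ⟨inferInstance, fun ε hε => ?_⟩)
  obtain ⟨P, hP, hev⟩ := H.exists_approx hk hζ hg (show 0 < ε / 4 by positivity)
  have hP1 : ∀ᶠ y in 𝓝[Ioo (-1 : ℝ) 1] 1, dist (P y) (P 1) < ε / 4 :=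
    (Metric.tendsto_nhds.mp hP _ (by positivity)).filter_mono nhdsWithin_le_nhds
  have hev2 : ∀ᶠ y in 𝓝[Ioo (-1 : ℝ) 1] 1, dist (g y) (P 1) < ε / 2 := by
    filter_upwards [hev, hP1] with y h1 h2
    rw [Real.rpow_zero, one_mul, ← Real.dist_eq] at h1
    linarith [dist_triangle (g y) (P y) (P 1)]
  refine ⟨g '' _, image_mem_map hev2, ?_⟩
  rintro _ ⟨x, hx, rfl⟩ _ ⟨y, hy, rfl⟩
  have hx' : dist (g x) (P 1) < ε / 2 := hx
  have hy' : dist (g y) (P 1) < ε / 2 := hy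
  linarith [dist_triangle_right (g x) (g y) (P 1)]

lemma tendsto_neg_nhdsWithin_Ioo :
    Tendsto (fun x : ℝ => -x) (𝓝[Ioo (-1 : ℝ) 1] (-1)) (𝓝[Ioo (-1 : ℝ) 1] 1) := by
  refine tendsto_nhdsWithin_iff.mpr ⟨?_, ?_⟩
  · have : Tendsto (fun x : ℝ => -x) (𝓝 (-1)) (𝓝 (- -1)) := continuous_neg.tendsto _
    rw [neg_neg] at this
    exact this.mono_left nhdsWithin_le_nhds
  · filter_upwards [self_mem_nhdsWithin] with x hx
    exact ⟨by linarith [hx.2], by linarith [hx.1]⟩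

lemma continuousOn_comp_neg {g : ℝ → ℝ} (hg : ContinuousOn g (Ioo (-1) 1)) :
    ContinuousOn (fun x => g (-x)) (Ioo (-1) 1) :=
  hg.comp continuous_neg.continuousOn fun x hx => ⟨by linarith [hx.2], by linarith [hx.1]⟩

lemma SmallDiff.tendsto_weighted_neg_one {k : ℕ} (hk : 1 ≤ k) {ξ ζ : ℝ} (hξ : 0 ≤ ξ) (hζ : 0 < ζ)
    {g : ℝ → ℝ} (hg : ContinuousOn g (Ioo (-1) 1)) (H : SmallDiff k ξ ζ g) :
    Tendsto (fun x => jw ξ ζ x * g x) (𝓝[Ioo (-1 : ℝ) 1] (-1)) (𝓝 0) :=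
  ((H.comp_neg.tendsto_weighted hk hζ hξ (continuousOn_comp_neg hg)).comp
    tendsto_neg_nhdsWithin_Ioo).congr fun x => by simp [jw_neg]

lemma SmallDiff.exists_tendsto_neg_one {k : ℕ} (hk : 1 ≤ k) {ξ : ℝ} (hξ : 0 ≤ ξ)
    {g : ℝ → ℝ} (hg : ContinuousOn g (Ioo (-1) 1)) (H : SmallDiff k ξ 0 g) :
    ∃ L : ℝ, Tendsto g (𝓝[Ioo (-1 : ℝ) 1] (-1)) (𝓝 L) := by
  obtain ⟨L, hL⟩ := H.comp_neg.exists_tendsto hk hξ (continuousOn_comp_neg hg)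
  exact ⟨L, (hL.comp tendsto_neg_nhdsWithin_Ioo).congr fun x => by simp⟩

lemma abs_mul_nodeSum_le {k : ℕ} (hk : 1 ≤ k) {s : ℝ} (hs : 0 ≤ s) {g : ℝ → ℝ} {x w L η : ℝ}
    (h : ∀ y ∈ Icc (x - k * s / 2) (x + k * s / 2), |w * (g y - L)| ≤ η) :
    |w * nodeSum k s g x| ≤ 2 ^ k * η := by
  rw [← nodeSum_sub_const hk s g L, nodeSum, Finset.mul_sum]
  have hsum : (2 : ℝ) ^ k * η = ∑ i ∈ Finset.range (k + 1), (k.choose i : ℝ) * η := by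
    rw [← Finset.sum_mul]
    congr 1
    exact_mod_cast (Nat.sum_range_choose k).symm
  rw [hsum]
  refine (Finset.abs_sum_le_sum_abs _ _).trans (Finset.sum_le_sum fun i hi => ?_)
  have e : ∀ c : ℝ, w * ((k.choose i : ℝ) * (-1) ^ (k - i) * c)
      = (-1) ^ (k - i) * ((k.choose i : ℝ) * (w * c)) := fun c => by ring
  rw [e, abs_mul, abs_pow, abs_neg, abs_one, one_pow, one_mul, abs_mul, Nat.abs_cast]
  exact mul_le_mul_of_nonneg_left (h _ (node_mem hi hs x)) (Nat.cast_nonneg _)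

lemma smallDiff_of_tendsto {k : ℕ} (hk : 1 ≤ k) {ξ ζ : ℝ} (hξ : 0 ≤ ξ) (hζ : 0 ≤ ζ)
    {g : ℝ → ℝ} (hg : ContinuousOn g (Ioo (-1) 1)) {L₁ L₂ : ℝ}
    (h₁ : Tendsto (fun x => jw ξ ζ x * (g x - L₁)) (𝓝[Ioo (-1 : ℝ) 1] 1) (𝓝 0))
    (h₂ : Tendsto (fun x => jw ξ ζ x * (g x - L₂)) (𝓝[Ioo (-1 : ℝ) 1] (-1)) (𝓝 0)) :
    SmallDiff k ξ ζ g := by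
  intro ε hε
  set η := ε / 2 ^ k with hη
  have hη0 : 0 < η := by positivity
  obtain ⟨δ₁, hδ₁, H₁⟩ := Metric.tendsto_nhdsWithin_nhds.mp h₁ η hη0
  obtain ⟨δ₂, hδ₂, H₂⟩ := Metric.tendsto_nhdsWithin_nhds.mp h₂ η hη0
  obtain ⟨δ, hδ, hδ1, hδ2⟩ : ∃ δ > 0, δ ≤ δ₁ ∧ δ ≤ δ₂ :=
    ⟨min δ₁ δ₂, lt_min hδ₁ hδ₂, min_le_left _ _, min_le_right _ _⟩
  have huc : UniformContinuousOn g (Icc (-1 + δ / 4) (1 - δ / 4)) :=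
    isCompact_Icc.uniformContinuousOn_of_continuous
      (hg.mono fun x hx => ⟨by linarith [hx.1], by linarith [hx.2]⟩)
  set M : ℝ := 2 ^ ξ * 2 ^ ζ with hM
  have hM0 : 0 < M := by positivity
  obtain ⟨ρ, hρ, Hρ⟩ := Metric.uniformContinuousOn_iff.mp huc (η / M) (by positivity)
  have hk0 : (0 : ℝ) < k := by exact_mod_cast hk
  refine ⟨min (δ / 4) ρ / k, by positivity, fun h hh x hx1 hx2 => ?_⟩
  have hs : 0 ≤ h * phi x := mul_nonneg hh.1.le (phi_nonneg x)
  have hkh : k * h ≤ min (δ / 4) ρ := by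
    have := (le_div_iff₀ hk0).mp hh.2
    linarith
  have hstep : k * (h * phi x) ≤ min (δ / 4) ρ := by
    refine le_trans ?_ hkh
    rw [← mul_assoc]
    exact mul_le_of_le_one_right (by have := hh.1; positivity) (phi_le_one x)
  have hstep1 := hstep.trans (min_le_left _ _)
  have hstep2 := hstep.trans (min_le_right _ _)
  have hks : 0 ≤ k * (h * phi x) := by positivity
  have hx1' : -1 ≤ x - k * h * phi x / 2 := by rw [mul_assoc]; exact hx1.le
  have hx2' : x + k * h * phi x / 2 ≤ 1 := by rw [mul_assoc]; exact hx2.le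
  have hw0 : 0 ≤ jwt (k * h) ξ ζ x := jwt_nonneg hx1' hx2'
  have hw : ∀ y ∈ Icc (x - k * (h * phi x) / 2) (x + k * (h * phi x) / 2),
      jwt (k * h) ξ ζ x ≤ jw ξ ζ y := fun y hy =>
    jwt_le_jw hξ hζ hx1' hx2' (by rwa [mul_assoc])
  suffices ∃ L, ∀ y ∈ Icc (x - k * (h * phi x) / 2) (x + k * (h * phi x) / 2),
      |jwt (k * h) ξ ζ x * (g y - L)| ≤ η by
    obtain ⟨L, hL⟩ := this
    refine (abs_mul_nodeSum_le hk hs hL).trans (le_of_eq ?_)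
    rw [hη]; field_simp
  have hend : ∀ y ∈ Icc (x - k * (h * phi x) / 2) (x + k * (h * phi x) / 2), ∀ L,
      dist (jw ξ ζ y * (g y - L)) 0 < η → |jwt (k * h) ξ ζ x * (g y - L)| ≤ η := by
    intro y hy L hd
    rw [Real.dist_eq, sub_zero, abs_mul, abs_of_nonneg (hw0.trans (hw y hy))] at hd
    rw [abs_mul, abs_of_nonneg hw0]
    exact (mul_le_mul_of_nonneg_right (hw y hy) (abs_nonneg _)).trans hd.le
  rcases le_total (1 - δ / 2) x with hxr | hxr
  · refine ⟨L₁, fun y hy => hend y hy L₁ (H₁ ⟨by linarith [hy.1], by linarith [hy.2]⟩ ?_)⟩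
    rw [Real.dist_eq, abs_lt]
    exact ⟨by linarith [hy.1], by linarith [hy.2]⟩
  rcases le_total x (-1 + δ / 2) with hxl | hxl
  · refine ⟨L₂, fun y hy => hend y hy L₂ (H₂ ⟨by linarith [hy.1], by linarith [hy.2]⟩ ?_)⟩
    rw [Real.dist_eq, abs_lt]
    exact ⟨by linarith [hy.1], by linarith [hy.2]⟩
  · refine ⟨g x, fun y hy => ?_⟩
    have hd := Hρ y ⟨by linarith [hy.1], by linarith [hy.2]⟩ x ⟨by linarith, by linarith⟩ (by
      rw [Real.dist_eq, abs_lt]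
      exact ⟨by linarith [hy.1], by linarith [hy.2]⟩)
    rw [Real.dist_eq] at hd
    have hwM : jwt (k * h) ξ ζ x ≤ M :=
      (hw y hy).trans (jw_le hξ hζ ⟨by linarith [hy.1], by linarith [hy.2]⟩)
    rw [abs_mul, abs_of_nonneg hw0]
    calc jwt (k * h) ξ ζ x * |g y - g x| ≤ M * (η / M) := by gcongr
      _ = η := by field_simp

lemma tendsto_jw_mul_sub {ξ ζ : ℝ} (hξ : 0 ≤ ξ) (hζ : 0 ≤ ζ) {g : ℝ → ℝ} {L c : ℝ} {s : Set ℝ}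
    (h : Tendsto g (𝓝[s] c) (𝓝 L)) :
    Tendsto (fun x => jw ξ ζ x * (g x - L)) (𝓝[s] c) (𝓝 0) := by
  have := (((continuous_jw hξ hζ).tendsto c).mono_left nhdsWithin_le_nhds).mul
    (h.sub (tendsto_const_nhds (x := L)))
  simpa using this

theorem stmt14 (k r : ℕ) (hk : 1 ≤ k) (a b : ℝ)
    (ha : 0 ≤ (r : ℝ) / 2 + a) (hb : 0 ≤ (r : ℝ) / 2 + b)
    (f : ℝ → ℝ) (hf : MemB ∞ r a b f) (hC : ContDiffOn ℝ r f (Ioo (-1) 1)) :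
    (0 < (r : ℝ) / 2 + a → 0 < (r : ℝ) / 2 + b →
      (Tendsto (fun t => wmod k r a b ∞ (iteratedDeriv r f) t) (𝓝[>] (0 : ℝ)) (𝓝 0) ↔
        Tendsto (fun x => jw a b x * phi x ^ r * iteratedDeriv r f x)
            (𝓝[Ioo (-1 : ℝ) 1] 1) (𝓝 0) ∧
          Tendsto (fun x => jw a b x * phi x ^ r * iteratedDeriv r f x)
            (𝓝[Ioo (-1 : ℝ) 1] (-1)) (𝓝 0))) ∧
    (0 < (r : ℝ) / 2 + a → (r : ℝ) / 2 + b = 0 →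
      (Tendsto (fun t => wmod k r a b ∞ (iteratedDeriv r f) t) (𝓝[>] (0 : ℝ)) (𝓝 0) ↔
        Tendsto (fun x => jw a b x * phi x ^ r * iteratedDeriv r f x)
            (𝓝[Ioo (-1 : ℝ) 1] 1) (𝓝 0) ∧
          ∃ L : ℝ, Tendsto (iteratedDeriv r f) (𝓝[Ioo (-1 : ℝ) 1] (-1)) (𝓝 L))) ∧
    ((r : ℝ) / 2 + a = 0 → 0 < (r : ℝ) / 2 + b →
      (Tendsto (fun t => wmod k r a b ∞ (iteratedDeriv r f) t) (𝓝[>] (0 : ℝ)) (𝓝 0) ↔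
        Tendsto (fun x => jw a b x * phi x ^ r * iteratedDeriv r f x)
            (𝓝[Ioo (-1 : ℝ) 1] (-1)) (𝓝 0) ∧
          ∃ L : ℝ, Tendsto (iteratedDeriv r f) (𝓝[Ioo (-1 : ℝ) 1] 1) (𝓝 L))) ∧
    ((r : ℝ) / 2 + a = 0 → (r : ℝ) / 2 + b = 0 →
      (Tendsto (fun t => wmod k r a b ∞ (iteratedDeriv r f) t) (𝓝[>] (0 : ℝ)) (𝓝 0) ↔
        (∃ L : ℝ, Tendsto (iteratedDeriv r f) (𝓝[Ioo (-1 : ℝ) 1] 1) (𝓝 L)) ∧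
          ∃ L : ℝ, Tendsto (iteratedDeriv r f) (𝓝[Ioo (-1 : ℝ) 1] (-1)) (𝓝 L))) := by
  set ξ := (r : ℝ) / 2 + a with hξ
  set ζ := (r : ℝ) / 2 + b with hζ
  set g := iteratedDeriv r f with hgdef
  have hg : ContinuousOn g (Ioo (-1) 1) :=
    (hC.continuousOn_iteratedDerivWithin le_rfl isOpen_Ioo.uniqueDiffOn).congr fun x hx =>
      (iteratedDerivWithin_of_isOpen isOpen_Ioo hx).symm
  have hw : ∀ c : ℝ, Tendsto (fun x => jw a b x * phi x ^ r * g x) (𝓝[Ioo (-1 : ℝ) 1] c) (𝓝 0) ↔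
      Tendsto (fun x => jw ξ ζ x * g x) (𝓝[Ioo (-1 : ℝ) 1] c) (𝓝 0) := fun c => by
    refine tendsto_congr' ?_
    filter_upwards [self_mem_nhdsWithin] with x hx
    rw [jw_mul_phi_pow r a b hx]
  have hsub : ∀ c : ℝ, Tendsto (fun x => jw ξ ζ x * g x) (𝓝[Ioo (-1 : ℝ) 1] c) (𝓝 0) →
      Tendsto (fun x => jw ξ ζ x * (g x - 0)) (𝓝[Ioo (-1 : ℝ) 1] c) (𝓝 0) := fun c h => by
    simpa using h
  simp only [tendsto_wmod_iff_smallDiff ha hb hg, hw]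
  refine ⟨fun h1 h2 => ⟨fun H => ?_, fun H => ?_⟩, fun h1 h2 => ⟨fun H => ?_, fun H => ?_⟩,
    fun h1 h2 => ⟨fun H => ?_, fun H => ?_⟩, fun h1 h2 => ⟨fun H => ?_, fun H => ?_⟩⟩
  · exact ⟨H.tendsto_weighted hk h1 hb hg, H.tendsto_weighted_neg_one hk ha h2 hg⟩
  · exact smallDiff_of_tendsto hk ha hb hg (hsub _ H.1) (hsub _ H.2)
  · refine ⟨H.tendsto_weighted hk h1 hb hg, ?_⟩
    change SmallDiff k ξ ζ g at H
    rw [h2] at H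
    exact H.exists_tendsto_neg_one hk ha hg
  · obtain ⟨H1, L, H2⟩ := H
    exact smallDiff_of_tendsto hk ha hb hg (hsub _ H1) (tendsto_jw_mul_sub ha hb H2)
  · refine ⟨H.tendsto_weighted_neg_one hk ha h2 hg, ?_⟩
    change SmallDiff k ξ ζ g at H
    rw [h1] at H
    exact H.exists_tendsto hk hb hg
  · obtain ⟨H1, L, H2⟩ := H
    exact smallDiff_of_tendsto hk ha hb hg (tendsto_jw_mul_sub ha hb H2) (hsub _ H1)
  · change SmallDiff k ξ ζ g at H
    rw [h1, h2] at H
    exact ⟨H.exists_tendsto hk le_rfl hg, H.exists_tendsto_neg_one hk le_rfl hg⟩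
  · obtain ⟨⟨L, H1⟩, L', H2⟩ := H
    exact smallDiff_of_tendsto hk ha hb hg (tendsto_jw_mul_sub ha hb H1)
      (tendsto_jw_mul_sub ha hb H2)

end
end
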